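/- Let λ ∈ ℝ and p = p(n) = 1/n + λn^{−4/3} + o(n^{−4/3}). There exists C > 0 such that for all n large enough and all 1 ≤ m ≤ n^{2/3}: P[X_m has a complex strongly connected component] ≤ C·m³/n² and P[X_m has a strongly connected component containing a surplus edge] ≤ C·m³/n². Moreover, for every ε > 0 there exists C > 0 such that for all n large enough and all 1 ≤ m ≤ n^{2/3}: P[‖T_m‖ ≥ n^{1/3}ε] ≤ C·m²/n^{4/3} and P[X_m has a strongly connected component with more than n^{1/3}ε edges] ≤ C·m²/n^{4/3}. -/

import Mathlib

open Finset
open scoped Classical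

namespace RandomTree

/-- The state of the depth-first exploration: the ordered stack of open vertices and the
list of explored vertices, in order of exploration. -/
structure St (m : ℕ) where
  stack : List (Fin m)
  visited : List (Fin m)

/-- One step of the depth-first exploration of the graph with adjacency `adj`. -/
def step {m : ℕ} (adj : Fin m → Fin m → Bool) (s : St m) : St m :=
  match s.stack with
  | [] => s
  | v :: rest =>
    let visited' := s.visited ++ [v]
    let ns := (List.finRange m).filter
      (fun w => adj v w && !(decide (w ∈ s.stack)) && !(decide (w ∈ s.visited)))
    let stack' := ns ++ rest
    let stack'' := if stack'.isEmpty then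
        ((List.finRange m).filter (fun w => !(decide (w ∈ visited')))).take 1
      else stack'
    ⟨stack'', visited', ⟩

/-- The state of the depth-first exploration started at the root `r` after `i` steps. -/
def stateAt {m : ℕ} (adj : Fin m → Fin m → Bool) (r : Fin m) (i : ℕ) : St m :=
  (step adj)^[i] ⟨[r], []⟩

/-- `par` is the parent map of a tree on `Fin m` rooted at `r`: iterating the parent map
from any vertex leads to the root. -/
def IsPTree {m : ℕ} (par : Fin m → Fin m) (r : Fin m) : Prop :=
  par r = r ∧ ∀ v, ∃ k : ℕ, par^[k] v = r

/-- The set of (parent maps of) labelled trees on `Fin m` rooted at `r`. -/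
noncomputable def treeFinset (m : ℕ) (r : Fin m) : Finset (Fin m → Fin m) :=
  univ.filter (fun par => IsPTree par r)

/-- The adjacency function of the canonical plane embedding of the tree with parent map
`par`: edges from each vertex to its children (children are listed in increasing order of
label by the exploration itself). -/
def childAdj {m : ℕ} (par : Fin m → Fin m) (r : Fin m) : Fin m → Fin m → Bool :=
  fun v w => decide (w ≠ r) && decide (par w = v)

/-- The depth-first (planar) order of the vertices of the tree, as a list
`[v₁, …, v_m]`. -/
def dfsOrder {m : ℕ} (par : Fin m → Fin m) (r : Fin m) : List (Fin m) :=
  (stateAt (childAdj par r) r m).visited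

/-- The position of a vertex in the depth-first (planar) order. -/
def dfsPos {m : ℕ} (par : Fin m → Fin m) (r : Fin m) (v : Fin m) : ℕ :=
  (dfsOrder par r).findIdx (fun w => decide (w = v))

/-- The number of vertices of the subtree rooted at `v` (including `v`). -/
noncomputable def subSize {m : ℕ} (par : Fin m → Fin m) (v : Fin m) : ℕ :=
  Set.ncard {w : Fin m | ∃ k : ℕ, par^[k] w = v}

/-- The number of vertices of the subtree rooted at `v` lying outside the largest of the
subtrees rooted at a child of `v`. -/
noncomputable def outsideLargest {m : ℕ} (par : Fin m → Fin m) (r : Fin m) (v : Fin m) : ℕ :=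
  subSize par v - (univ.filter (fun c : Fin m => c ≠ r ∧ par c = v)).sup (subSize par)


/-- The permitted edges of the plane tree with parent map `par`: ordered pairs `(u, v)`
of distinct vertices, with `u` before `v` in the planar order (so `u` is the tail and `v`
the head), which at some step of the depth-first exploration are simultaneously on the
stack. -/
noncomputable def permitted {m : ℕ} (par : Fin m → Fin m) (r : Fin m) :
    Finset (Fin m × Fin m) :=
  univ.filter (fun x : Fin m × Fin m => x.1 ≠ x.2 ∧
    dfsPos par r x.1 < dfsPos par r x.2 ∧
    ∃ i ≤ m, x.1 ∈ (stateAt (childAdj par r) r i).stack ∧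
      x.2 ∈ (stateAt (childAdj par r) r i).stack)

/-- The probability weight of a configuration `s` of surplus edges: each permitted edge
is added independently with probability `p`; configurations containing a non-permitted
edge get weight `0`. -/
noncomputable def surpW {m : ℕ} (p : ℝ) (par : Fin m → Fin m) (r : Fin m)
    (s : Fin m → Fin m → Bool) : ℝ :=
  if ∀ u w, s u w = true → (u, w) ∈ permitted par r then
    ∏ x ∈ permitted par r, (if s x.1 x.2 then p else 1 - p)
  else 0

/-- The number `a(T)` of permitted edges ("area") of the plane tree with parent map `par`. -/
noncomputable def area {m : ℕ} (par : Fin m → Fin m) (r : Fin m) : ℕ :=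
  (permitted par r).card

/-- The height of the vertex `v`: its distance to the root. -/
noncomputable def hgt {m : ℕ} (par : Fin m → Fin m) (r : Fin m) (v : Fin m) : ℕ :=
  sInf {k : ℕ | par^[k] v = r}

/-- The height `‖T‖` of the tree: the largest distance from the root to a vertex. -/
noncomputable def treeHeight {m : ℕ} (par : Fin m → Fin m) (r : Fin m) : ℕ :=
  univ.sup (hgt par r)


/-- The probability weight of a configuration `b` of back edges: each pair `(vᵢ, vⱼ)`
with `j < i` in the planar order is a back edge independently with probability `p`;
configurations containing a non-backward pair get weight `0`. -/
noncomputable def backW {m : ℕ} (p : ℝ) (par : Fin m → Fin m) (r : Fin m)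
    (b : Fin m → Fin m → Bool) : ℝ :=
  if ∀ u w, b u w = true → dfsPos par r w < dfsPos par r u then
    ∏ x ∈ univ.filter (fun x : Fin m × Fin m => dfsPos par r x.2 < dfsPos par r x.1),
      (if b x.1 x.2 then p else 1 - p)
  else 0

/-- The probability weight of the tree `par` under the biased law of `T_m`:
proportional to `(1-p)^{-a(par)}` on trees, `0` on non-trees. -/
noncomputable def biasW {m : ℕ} (p : ℝ) (par : Fin m → Fin m) (r : Fin m) : ℝ :=
  if IsPTree par r then ((1 - p) ^ area par r)⁻¹ else 0

/-- `u` is an ancestor of `v` (inclusively) in the tree with parent map `par`. -/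
def Anc {m : ℕ} (par : Fin m → Fin m) (u v : Fin m) : Prop :=
  ∃ k : ℕ, par^[k] v = u

/-- The set of back edges present in the configuration `b`. -/
noncomputable def backFinset {m : ℕ} (b : Fin m → Fin m → Bool) :
    Finset (Fin m × Fin m) :=
  univ.filter (fun x : Fin m × Fin m => b x.1 x.2 = true)

/-- The lexicographic key (by planar order of the tail, then of the head) used to order
the back edges. -/
noncomputable def lexKey {m : ℕ} (par : Fin m → Fin m) (r : Fin m)
    (x : Fin m × Fin m) : Lex (ℕ × ℕ) :=
  toLex (dfsPos par r x.1, dfsPos par r x.2)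

/-- One step of the marking procedure on the set `B` of back edges: among the unmarked
elements `(x, y)` of `B` such that `y` lies on the union of the paths from the root to
`x` and to the tails of the already marked edges, mark the lexicographically smallest
(for the planar order) one, if any. -/
noncomputable def markStep {m : ℕ} (par : Fin m → Fin m) (r : Fin m)
    (B : Finset (Fin m × Fin m)) (marked : Finset (Fin m × Fin m)) :
    Finset (Fin m × Fin m) :=
  let cands := (B \ marked).filter
    (fun x => Anc par x.2 x.1 ∨ ∃ y ∈ marked, Anc par x.2 y.1)
  if h : cands.Nonempty then
    marked ∪ cands.filter
      (fun x => lexKey par r x = (cands.image (lexKey par r)).min' (h.image _))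
  else marked

/-- The marked subset `((x_{i,m}, y_{i,m}), i ≤ N_m)` of the back edges of the
configuration `b`. -/
noncomputable def markedEdges {m : ℕ} (par : Fin m → Fin m) (r : Fin m)
    (b : Fin m → Fin m → Bool) : Finset (Fin m × Fin m) :=
  (markStep par r (backFinset b))^[(backFinset b).card] ∅

/-- The edge relation of the random directed graph `X_m`: the tree edges (directed away
from the root), the back edges of `b` and the surplus edges of `s`. -/
def edgeX {m : ℕ} (par : Fin m → Fin m) (r : Fin m)
    (b s : Fin m → Fin m → Bool) (a c : Fin m) : Prop :=
  (c ≠ r ∧ par c = a) ∨ b a c = true ∨ s a c = true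

/-- The edge relation of `X_m*`: the tree edges together with the marked back edges only
(all surplus edges and unmarked back edges removed). -/
def edgeXstar {m : ℕ} (par : Fin m → Fin m) (r : Fin m)
    (b : Fin m → Fin m → Bool) (a c : Fin m) : Prop :=
  (c ≠ r ∧ par c = a) ∨ (a, c) ∈ markedEdges par r b

/-- Two vertices lie in the same strongly connected component of the directed graph with
edge relation `E`. -/
def SameSCC {m : ℕ} (E : Fin m → Fin m → Prop) (u v : Fin m) : Prop :=
  Relation.ReflTransGen E u v ∧ Relation.ReflTransGen E v u

/-- The directed graphs with edge relations `E` and `E'` (on the same vertex set) have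
the same strongly connected components: they induce the same partition into strongly
connected components, and each component carries the same edges in both. -/
def SameSCCs {m : ℕ} (E E' : Fin m → Fin m → Prop) : Prop :=
  (∀ u v, SameSCC E u v ↔ SameSCC E' u v) ∧
  (∀ u v, (E u v ∧ SameSCC E u v) ↔ (E' u v ∧ SameSCC E' u v))

/-- The probability, under the law of `(T_m, X_m)` (the tree biased by `(1-p)^{-a(·)}`,
back edges and surplus edges added independently with probability `p`), of the event
`ev`. -/
noncomputable def modelProb (m : ℕ) (p : ℝ)
    (ev : ∀ m' : ℕ, (Fin m' → Fin m') → Fin m' →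
      (Fin m' → Fin m' → Bool) → (Fin m' → Fin m' → Bool) → Prop) : ℝ :=
  if h : 0 < m then
    let r : Fin m := ⟨0, h⟩
    (∑ par : Fin m → Fin m, ∑ b : Fin m → Fin m → Bool, ∑ s : Fin m → Fin m → Bool,
      biasW p par r * backW p par r b * surpW p par r s *
        (if ev m par r b s then 1 else 0))
      / (∑ par : Fin m → Fin m, biasW p par r)
  else 0

end RandomTree

namespace RandomTree

/-- The set of edges of the directed graph with edge relation `E` lying inside the
strongly connected component of the vertex `u`. -/
def sccEdges {m : ℕ} (E : Fin m → Fin m → Prop) (u : Fin m) : Set (Fin m × Fin m) :=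
  {x : Fin m × Fin m | E x.1 x.2 ∧ SameSCC E u x.1 ∧ SameSCC E u x.2}

/-- The directed graph with edge relation `E` has a complex strongly connected
component: one with strictly more edges than vertices. -/
def HasComplexSCC {m : ℕ} (E : Fin m → Fin m → Prop) : Prop :=
  ∃ u : Fin m, Set.ncard {v : Fin m | SameSCC E u v} < (sccEdges E u).ncard

end RandomTree

namespace RandomTree

/-- Following the map `par` from `v` eventually leads into `R`. -/
inductive Reaches {m : ℕ} (par : Fin m → Fin m) (R : Finset (Fin m)) : Fin m → Prop
  | base {v : Fin m} (h : v ∈ R) : Reaches par R v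
  | step {v : Fin m} (h : Reaches par R (par v)) : Reaches par R v

theorem reaches_iff {m : ℕ} {par : Fin m → Fin m} {R : Finset (Fin m)} {v : Fin m} :
    Reaches par R v ↔ ∃ k : ℕ, par^[k] v ∈ R := by
  constructor
  · intro h
    induction h with
    | base h => exact ⟨0, h⟩
    | step _ ih =>
      obtain ⟨k, hk⟩ := ih
      exact ⟨k + 1, by simpa using hk⟩
  · rintro ⟨k, hk⟩
    induction k generalizing v with
    | zero => exact .base hk
    | succ k ih => exact .step (ih (by simpa using hk))

theorem IsPTree.reaches {m : ℕ} {par : Fin m → Fin m} {r : Fin m} (h : IsPTree par r)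
    (v : Fin m) : Reaches par {r} v :=
  reaches_iff.2 (by simpa using h.2 v)

theorem Anc.refl {m : ℕ} {par : Fin m → Fin m} (v : Fin m) : Anc par v v := ⟨0, rfl⟩

theorem Anc.trans {m : ℕ} {par : Fin m → Fin m} {u v w : Fin m} (h : Anc par u v)
    (h' : Anc par v w) : Anc par u w := by
  obtain ⟨k, rfl⟩ := h
  obtain ⟨l, rfl⟩ := h'
  exact ⟨k + l, by rw [Function.iterate_add_apply]⟩

theorem anc_par {m : ℕ} {par : Fin m → Fin m} (v : Fin m) : Anc par (par v) v := ⟨1, rfl⟩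

theorem Anc.eq_or_anc_par {m : ℕ} {par : Fin m → Fin m} {u v : Fin m} (h : Anc par u v) :
    u = v ∨ Anc par u (par v) := by
  obtain ⟨k, rfl⟩ := h
  cases k with
  | zero => exact .inl rfl
  | succ k => exact .inr ⟨k, by simp⟩

/-- The invariant of the depth-first exploration of a tree. -/
structure ExplInv {m : ℕ} (par : Fin m → Fin m) (r : Fin m) (s : St m) : Prop where
  nodup : (s.visited ++ s.stack).Nodup
  root_mem : r ∈ s.visited ++ s.stack
  par_mem : ∀ w ∈ s.visited ++ s.stack, w ≠ r → par w ∈ s.visited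
  child_mem : ∀ v ∈ s.visited, ∀ w, w ≠ r → par w = v → w ∈ s.visited ++ s.stack
  stack_pw : s.stack.Pairwise (fun a b => a ≠ r ∧ b ≠ r ∧ Anc par (par b) (par a))

theorem explInv_init {m : ℕ} (par : Fin m → Fin m) (r : Fin m) :
    ExplInv par r ⟨[r], []⟩ := by
  constructor <;> simp

theorem ExplInv.exists_anc_stack {m : ℕ} {par : Fin m → Fin m} {r : Fin m}
    (ht : IsPTree par r) {s : St m} (hs : ExplInv par r s) (x : Fin m) (hx : x ∉ s.visited) :
    ∃ y ∈ s.stack, Anc par y x := by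
  have h := ht.reaches x
  induction h with
  | @base v h =>
    have := hs.root_mem
    obtain rfl : v = r := by simpa using h
    exact ⟨v, by simpa [hx] using this, Anc.refl v⟩
  | @step v h ih =>
    by_cases hv : v ∈ s.stack
    · exact ⟨v, hv, Anc.refl v⟩
    by_cases hvr : v = r
    · have := hs.root_mem
      simp_all
    · have : par v ∉ s.visited := fun h' => by
        have := hs.child_mem _ h' v hvr rfl
        simp_all
      obtain ⟨y, hy, hyv⟩ := ih this
      exact ⟨y, hy, hyv.trans (anc_par v)⟩

theorem ExplInv.anc_mem_visited {m : ℕ} {par : Fin m → Fin m} {r : Fin m}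
    (hr : par r = r) {s : St m} (hs : ExplInv par r s) {u v : Fin m} (hv : v ∈ s.visited)
    (h : Anc par u v) : u ∈ s.visited := by
  obtain ⟨k, rfl⟩ := h
  induction k with
  | zero => exact hv
  | succ k ih =>
    rw [Function.iterate_succ_apply']
    by_cases h' : par^[k] v = r
    · rw [h', hr, ← h']; exact ih
    · exact hs.par_mem _ (by simp [ih]) h'

theorem Reaches.anc_antisymm {m : ℕ} {par : Fin m → Fin m} {r : Fin m} (hr : par r = r)
    {u v : Fin m} (hv : Reaches par {r} v) (h : Anc par u v) (h' : Anc par v u) : u = v := by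
  obtain ⟨k, hk⟩ := h
  obtain ⟨l, hl⟩ := h'
  rcases Nat.eq_zero_or_pos k with rfl | hk0
  · exact hk.symm
  have hper : par^[l + k] v = v := by rw [Function.iterate_add_apply, hk, hl]
  obtain ⟨j, hj⟩ := reaches_iff.1 hv
  rw [mem_singleton] at hj
  have hfix : ∀ i, par^[i] r = r := fun i => Function.iterate_fixed hr i
  have h1 : v = r := by
    have h2 : par^[(l + k) * j] v = v := by
      rw [Function.iterate_mul]; exact Function.iterate_fixed hper j
    have h3 : (l + k) * j = ((l + k) * j - j) + j := by
      have : j ≤ (l + k) * j := Nat.le_mul_of_pos_left _ (by omega)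
      omega
    rw [h3, Function.iterate_add_apply, hj, hfix] at h2
    exact h2.symm
  rw [← hk, h1, hfix]

theorem IsPTree.anc_antisymm {m : ℕ} {par : Fin m → Fin m} {r : Fin m} (ht : IsPTree par r)
    {u v : Fin m} (h : Anc par u v) (h' : Anc par v u) : u = v :=
  (ht.reaches v).anc_antisymm ht.1 h h'

/-- The effect of a step of the exploration at a state with a nonempty stack. -/
theorem step_cons {m : ℕ} {par : Fin m → Fin m} {r : Fin m} (ht : IsPTree par r) {s : St m}
    (hs : ExplInv par r s) {v : Fin m} {rest : List (Fin m)} (hst : s.stack = v :: rest) :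
    ∃ ns : List (Fin m), ns.Nodup ∧ (∀ w, w ∈ ns ↔ w ≠ r ∧ par w = v) ∧
      step (childAdj par r) s = ⟨ns ++ rest, s.visited ++ [v]⟩ ∧
      ExplInv par r ⟨ns ++ rest, s.visited ++ [v]⟩ := by
  set ns := (List.finRange m).filter
      (fun w => childAdj par r v w && !(decide (w ∈ s.stack)) && !(decide (w ∈ s.visited)))
    with hns
  have hnd := hs.nodup
  have hvv : v ∉ s.visited := by
    intro h
    rw [hst, List.nodup_append] at hnd
    exact hnd.2.2 v h v (by simp) rfl
  have hmem : ∀ w, w ∈ ns ↔ w ≠ r ∧ par w = v := by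
    intro w
    simp only [hns, List.mem_filter, List.mem_finRange, true_and, childAdj, Bool.and_eq_true,
      decide_eq_true_eq, Bool.not_eq_true', decide_eq_false_iff_not]
    constructor
    · rintro ⟨⟨h, -⟩, -⟩; exact h
    · rintro ⟨h1, h2⟩
      have key : w ∉ s.visited ++ s.stack := fun h => hvv (h2 ▸ hs.par_mem w h h1)
      simp only [List.mem_append, not_or] at key
      exact ⟨⟨⟨h1, h2⟩, key.2⟩, key.1⟩
  have hnsn : ∀ w ∈ ns, w ∉ s.visited ++ s.stack := by
    intro w hw h
    rw [hmem] at hw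
    exact hvv (hw.2 ▸ hs.par_mem w h hw.1)
  have hnsnd : ns.Nodup := (List.nodup_finRange m).filter _
  have hinv : ExplInv par r ⟨ns ++ rest, s.visited ++ [v]⟩ := by
    have hpw := hs.stack_pw
    rw [hst] at hpw hnd hnsn
    refine ⟨?_, ?_, ?_, ?_, ?_⟩
    · simp only [List.nodup_append, List.nodup_cons, List.mem_append, List.mem_cons,
        List.append_assoc, List.singleton_append] at hnd hnsn ⊢
      refine ⟨hnd.1, ⟨?_, hnsnd, hnd.2.1.2, ?_⟩, ?_⟩
      · rintro (h | h)
        · exact hnsn v h (by simp)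
        · exact hnd.2.1.1 h
      · rintro a ha b hb rfl
        exact hnsn a ha (by simp [hb])
      · rintro a ha b (rfl | hb | hb) rfl
        · exact hvv ha
        · exact hnsn a hb (by simp [ha])
        · exact hnd.2.2 a ha a (by simp [hb]) rfl
    · have := hs.root_mem
      rw [hst] at this
      simp only [List.mem_append, List.mem_cons] at this ⊢
      grind
    · intro w hw hwr
      have := hs.par_mem w
      rw [hst] at this
      simp only [List.mem_append, List.mem_cons] at this hw ⊢
      grind
    · intro a ha w hw hwa
      have := hs.child_mem a
      rw [hst] at this
      simp only [List.mem_append, List.mem_cons] at this ha ⊢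
      grind
    · rw [List.pairwise_cons] at hpw
      rw [List.pairwise_append]
      refine ⟨?_, hpw.2, ?_⟩
      · refine (hnsnd.pairwise_of_forall_ne ?_)
        intro a ha b hb _
        rw [hmem] at ha hb
        exact ⟨ha.1, hb.1, by rw [ha.2, hb.2]; exact Anc.refl v⟩
      · intro a ha b hb
        rw [hmem] at ha
        obtain ⟨h1, h2, h3⟩ := hpw.1 b hb
        exact ⟨ha.1, h2, by rw [ha.2]; exact h3.trans (anc_par v)⟩
  refine ⟨ns, hnsnd, hmem, ?_, hinv⟩
  have hstep : step (childAdj par r) s =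
      ⟨if (ns ++ rest).isEmpty then
        ((List.finRange m).filter (fun w => !(decide (w ∈ s.visited ++ [v])))).take 1
      else ns ++ rest, s.visited ++ [v]⟩ := by
    conv_lhs => rw [step]
    split
    · simp_all
    · rename_i v' rest' h
      rw [hst] at h
      obtain ⟨rfl, rfl⟩ := List.cons.inj h
      simp only [hns, hst]
  rw [hstep]
  congr 1
  split_ifs with h
  · have h0 : ns ++ rest = [] := by simpa using h
    rw [h0]
    have : (List.finRange m).filter (fun w => !(decide (w ∈ s.visited ++ [v]))) = [] := by
      rw [List.filter_eq_nil_iff]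
      intro w _
      by_contra hw
      obtain ⟨y, hy, _⟩ := hinv.exists_anc_stack ht w (by simpa using hw)
      simp [h0] at hy
    rw [this]; rfl
  · rfl

theorem step_nil {m : ℕ} {adj : Fin m → Fin m → Bool} {s : St m} (h : s.stack = []) :
    step adj s = s := by
  rw [step]; split
  · rfl
  · simp_all

theorem stateAt_succ {m : ℕ} (adj : Fin m → Fin m → Bool) (r : Fin m) (i : ℕ) :
    stateAt adj r (i + 1) = step adj (stateAt adj r i) := by
  simp only [stateAt, Function.iterate_succ_apply']

theorem explInv_stateAt {m : ℕ} {par : Fin m → Fin m} {r : Fin m} (ht : IsPTree par r) (i : ℕ) :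
    ExplInv par r (stateAt (childAdj par r) r i) := by
  induction i with
  | zero => exact explInv_init par r
  | succ i ih =>
    rw [stateAt_succ]
    rcases h : (stateAt (childAdj par r) r i).stack with _ | ⟨v, rest⟩
    · rw [step_nil h]; exact ih
    · obtain ⟨ns, -, -, h1, h2⟩ := step_cons ht ih h
      rw [h1]; exact h2

/-- The vertices discovered after `i` steps: the explored ones, then the stack. -/
def seen {m : ℕ} (par : Fin m → Fin m) (r : Fin m) (i : ℕ) : List (Fin m) :=
  (stateAt (childAdj par r) r i).visited ++ (stateAt (childAdj par r) r i).stack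

theorem seen_sublist_succ {m : ℕ} {par : Fin m → Fin m} {r : Fin m} (ht : IsPTree par r) (i : ℕ) :
    (seen par r i).Sublist (seen par r (i + 1)) := by
  unfold seen
  rw [stateAt_succ]
  rcases h : (stateAt (childAdj par r) r i).stack with _ | ⟨v, rest⟩
  · rw [step_nil h, h]
  · obtain ⟨ns, -, -, h1, h2⟩ := step_cons ht (explInv_stateAt ht i) h
    rw [h1]
    simp

theorem seen_sublist {m : ℕ} {par : Fin m → Fin m} {r : Fin m} (ht : IsPTree par r) {i j : ℕ}
    (h : i ≤ j) : (seen par r i).Sublist (seen par r j) := by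
  induction h with
  | refl => exact List.Sublist.refl _
  | step _ ih => exact ih.trans (seen_sublist_succ ht _)

theorem length_visited {m : ℕ} {par : Fin m → Fin m} {r : Fin m} (ht : IsPTree par r) (i : ℕ) :
    (stateAt (childAdj par r) r i).stack = [] ∨
      (stateAt (childAdj par r) r i).visited.length = i := by
  induction i with
  | zero => exact .inr rfl
  | succ i ih =>
    rw [stateAt_succ]
    rcases h : (stateAt (childAdj par r) r i).stack with _ | ⟨v, rest⟩
    · rw [step_nil h]; exact .inl h
    · obtain ⟨ns, -, -, h1, h2⟩ := step_cons ht (explInv_stateAt ht i) h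
      rw [h1]
      rw [h] at ih
      right
      simpa using ih

theorem stack_final {m : ℕ} {par : Fin m → Fin m} {r : Fin m} (ht : IsPTree par r) :
    (stateAt (childAdj par r) r m).stack = [] := by
  rcases length_visited ht m with h | h
  · exact h
  · have h1 := (explInv_stateAt ht m).nodup.length_le_card
    rw [List.length_append, h, Fintype.card_fin] at h1
    exact List.length_eq_zero_iff.1 (by omega)

theorem seen_final {m : ℕ} {par : Fin m → Fin m} {r : Fin m} (ht : IsPTree par r) :
    seen par r m = dfsOrder par r := by
  rw [seen, stack_final ht, dfsOrder, List.append_nil]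

theorem nodup_dfsOrder {m : ℕ} {par : Fin m → Fin m} {r : Fin m} (ht : IsPTree par r) :
    (dfsOrder par r).Nodup := by
  have := (explInv_stateAt ht m).nodup
  rwa [stack_final ht, List.append_nil] at this

theorem mem_dfsOrder {m : ℕ} {par : Fin m → Fin m} {r : Fin m} (ht : IsPTree par r) (v : Fin m) :
    v ∈ dfsOrder par r := by
  by_contra h
  obtain ⟨y, hy, -⟩ := (explInv_stateAt ht m).exists_anc_stack ht v h
  rw [stack_final ht] at hy
  simp at hy

theorem dfsPos_lt_of_sublist {m : ℕ} {par : Fin m → Fin m} {r : Fin m} (ht : IsPTree par r)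
    {a b : Fin m} (h : [a, b].Sublist (dfsOrder par r)) : dfsPos par r a < dfsPos par r b := by
  have hnd := nodup_dfsOrder ht
  unfold dfsPos
  generalize dfsOrder par r = l at h hnd
  induction l with
  | nil => simp at h
  | cons c l ih =>
    rw [List.nodup_cons] at hnd
    rw [List.findIdx_cons, List.findIdx_cons]
    rcases List.sublist_cons_iff.1 h with h | ⟨l', hl, h⟩
    · have ha : a ∈ l := h.subset (by simp)
      have hb : b ∈ l := h.subset (by simp)
      have hca : c ≠ a := fun e => hnd.1 (e ▸ ha)
      have hcb : c ≠ b := fun e => hnd.1 (e ▸ hb)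
      simpa [hca, hcb] using ih h hnd.2
    · obtain ⟨rfl, rfl⟩ := List.cons.inj hl
      have hcb : a ≠ b := fun e => hnd.1 (e ▸ h.subset (by simp))
      simp [hcb]

theorem dfsPos_lt_of_seen {m : ℕ} {par : Fin m → Fin m} {r : Fin m} (ht : IsPTree par r)
    {a b : Fin m} {i : ℕ} (hi : i ≤ m) (h : [a, b].Sublist (seen par r i)) :
    dfsPos par r a < dfsPos par r b :=
  dfsPos_lt_of_sublist ht (seen_final ht ▸ h.trans (seen_sublist ht hi))

theorem dfsPos_injective {m : ℕ} {par : Fin m → Fin m} {r : Fin m} (ht : IsPTree par r) :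
    Function.Injective (dfsPos par r) := by
  intro a b hab
  unfold dfsPos at hab
  have ha := List.findIdx_getElem (p := fun w => decide (w = a)) (xs := dfsOrder par r)
    (w := List.findIdx_lt_length_of_exists ⟨a, mem_dfsOrder ht a, by simp⟩)
  have hb := List.findIdx_getElem (p := fun w => decide (w = b)) (xs := dfsOrder par r)
    (w := List.findIdx_lt_length_of_exists ⟨b, mem_dfsOrder ht b, by simp⟩)
  simp only [decide_eq_true_eq] at ha hb
  rw [← ha, ← hb]
  congr 1

/-- The state in which a given vertex is about to be explored. -/
theorem exists_top {m : ℕ} {par : Fin m → Fin m} {r : Fin m} (ht : IsPTree par r) (v : Fin m) :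
    ∃ i < m, ∃ rest, (stateAt (childAdj par r) r i).stack = v :: rest := by
  have key : ∀ i, v ∈ (stateAt (childAdj par r) r i).visited →
      ∃ j < i, ∃ rest, (stateAt (childAdj par r) r j).stack = v :: rest := by
    intro i
    induction i with
    | zero => intro h; simp [stateAt] at h
    | succ i ih =>
      intro h
      rw [stateAt_succ] at h
      rcases hs : (stateAt (childAdj par r) r i).stack with _ | ⟨w, rest⟩
      · rw [step_nil hs] at h
        obtain ⟨j, hj, h'⟩ := ih h
        exact ⟨j, by omega, h'⟩
      · obtain ⟨ns, -, -, h1, h2⟩ := step_cons ht (explInv_stateAt ht i) hs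
        rw [h1] at h
        simp only [List.mem_append, List.mem_singleton] at h
        rcases h with h | rfl
        · obtain ⟨j, hj, h'⟩ := ih h
          exact ⟨j, by omega, h'⟩
        · exact ⟨i, by omega, rest, hs⟩
  exact key m (mem_dfsOrder ht v)

theorem pair_sublist_append {α : Type*} {l₁ l₂ : List α} {a b : α} (ha : a ∈ l₁) (hb : b ∈ l₂) :
    [a, b].Sublist (l₁ ++ l₂) :=
  List.Sublist.append (l₁ := [a]) (r₁ := [b]) (by simpa using ha) (by simpa using hb)

/-- When `v` is explored, its children are placed between `v` and the rest of the stack. -/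
theorem dfsPos_lt_of_top {m : ℕ} {par : Fin m → Fin m} {r : Fin m} (ht : IsPTree par r)
    {v y : Fin m} {rest : List (Fin m)} {i : ℕ} (hi : i < m)
    (hs : (stateAt (childAdj par r) r i).stack = v :: rest) (hy : y ≠ r) (hyv : par y = v) :
    dfsPos par r v < dfsPos par r y ∧ ∀ x ∈ rest, dfsPos par r y < dfsPos par r x := by
  obtain ⟨ns, -, hns, h1, h2⟩ := step_cons ht (explInv_stateAt ht i) hs
  have hseen : seen par r (i + 1) =
      ((stateAt (childAdj par r) r i).visited ++ [v]) ++ (ns ++ rest) := by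
    rw [seen, stateAt_succ, h1]
  have hyn : y ∈ ns := (hns y).2 ⟨hy, hyv⟩
  refine ⟨dfsPos_lt_of_seen ht hi ?_, fun x hx => dfsPos_lt_of_seen ht hi ?_⟩
  · rw [hseen]
    exact pair_sublist_append (by simp) (by simp [hyn])
  · rw [hseen]
    exact (pair_sublist_append hyn hx).trans (List.sublist_append_right _ _)

theorem dfsPos_par_lt {m : ℕ} {par : Fin m → Fin m} {r : Fin m} (ht : IsPTree par r)
    {v : Fin m} (hv : v ≠ r) : dfsPos par r (par v) < dfsPos par r v := by
  obtain ⟨i, hi, rest, hs⟩ := exists_top ht (par v)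
  exact (dfsPos_lt_of_top ht hi hs hv rfl).1

theorem dfsPos_le_of_anc {m : ℕ} {par : Fin m → Fin m} {r : Fin m} (ht : IsPTree par r)
    {u v : Fin m} (h : Anc par u v) : dfsPos par r u ≤ dfsPos par r v := by
  obtain ⟨k, rfl⟩ := h
  induction k with
  | zero => exact le_rfl
  | succ k ih =>
    rw [Function.iterate_succ_apply']
    by_cases h : par^[k] v = r
    · rw [h, ht.1]; rwa [h] at ih
    · exact (dfsPos_par_lt ht h).le.trans ih

/-- Subtrees are intervals of the planar order. -/
theorem dfsPos_lt_of_anc {m : ℕ} {par : Fin m → Fin m} {r : Fin m} (ht : IsPTree par r)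
    {z x y : Fin m} (hzx : dfsPos par r z < dfsPos par r x) (hx : ¬ Anc par z x)
    (hy : Anc par z y) : dfsPos par r y < dfsPos par r x := by
  obtain ⟨k, hk⟩ := hy
  induction k generalizing y with
  | zero => rw [← hk] at hzx; exact hzx
  | succ k ih =>
    by_cases hyr : y = r
    · rw [hyr]
      have := dfsPos_le_of_anc ht (u := r) (v := z) (ht.2 z)
      omega
    have hy' : dfsPos par r (par y) < dfsPos par r x := ih (by simpa using hk)
    have hzy : Anc par z (par y) := ⟨k, by simpa using hk⟩
    obtain ⟨i, hi, rest, hs⟩ := exists_top ht (par y)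
    have hinv := explInv_stateAt ht i
    have hxv : x ∉ (stateAt (childAdj par r) r i).visited := by
      intro h
      have := dfsPos_lt_of_seen ht hi.le (a := x) (b := par y)
        (pair_sublist_append h (by simp [hs]))
      omega
    obtain ⟨ns, -, hns, h1, h2⟩ := step_cons ht hinv hs
    obtain ⟨x', hx', hx'x⟩ := h2.exists_anc_stack ht x (by
      simp only [List.mem_append, List.mem_singleton, not_or]
      exact ⟨hxv, fun e => hx (e ▸ hzy)⟩)
    simp only [List.mem_append] at hx'
    rcases hx' with hx' | hx'
    · rw [hns] at hx'
      exact absurd ((hx'.2 ▸ hzy : Anc par z (par x')).trans ((anc_par x').trans hx'x)) hx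
    · exact ((dfsPos_lt_of_top ht hi hs hyr rfl).2 x' hx').trans_le (dfsPos_le_of_anc ht hx'x)

theorem dfsPos_lt_of_exit {m : ℕ} {par : Fin m → Fin m} {r : Fin m} (ht : IsPTree par r)
    {z u v : Fin m} (hu : Anc par z u) (hv : ¬ Anc par z v)
    (h : dfsPos par r v < dfsPos par r u) : dfsPos par r v < dfsPos par r z := by
  by_contra hc
  have hne : dfsPos par r z ≠ dfsPos par r v := fun e =>
    hv (dfsPos_injective ht e ▸ Anc.refl z)
  have := dfsPos_lt_of_anc ht (lt_of_le_of_ne (not_lt.1 hc) hne) hv hu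
  omega

/-- The head of a permitted edge is a sibling of a strict ancestor of, or of, its tail. -/
theorem permitted_spec {m : ℕ} {par : Fin m → Fin m} {r : Fin m} (ht : IsPTree par r)
    {u v : Fin m} (h : (u, v) ∈ permitted par r) :
    u ≠ r ∧ v ≠ r ∧ Anc par (par v) (par u) ∧ ¬ Anc par v u := by
  simp only [permitted, mem_filter, mem_univ, true_and] at h
  obtain ⟨hne, hpos, i, hi, hu, hv⟩ := h
  have hinv := explInv_stateAt ht i
  have key : ∀ l : List (Fin m), u ∈ l → v ∈ l → [u, v].Sublist l ∨ [v, u].Sublist l := by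
    intro l hul hvl
    induction l with
    | nil => simp at hul
    | cons a l ih =>
      simp only [List.mem_cons] at hul hvl
      rcases hul with rfl | hul
      · rcases hvl with rfl | hvl
        · exact absurd rfl hne
        · exact .inl (List.cons_sublist_cons.2 (by simpa using hvl))
      · rcases hvl with rfl | hvl
        · exact .inr (List.cons_sublist_cons.2 (by simpa using hul))
        · exact (ih hul hvl).imp (fun h => h.trans (List.sublist_cons_self _ _))
            (fun h => h.trans (List.sublist_cons_self _ _))
  rcases key _ hu hv with h | h
  · have hp := hinv.stack_pw.sublist h
    simp only [List.pairwise_cons, List.mem_singleton, forall_eq] at hp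
    obtain ⟨⟨h1, h2, h3⟩, -⟩ := hp
    refine ⟨h1, h2, h3, fun hvu => ?_⟩
    rcases hvu.eq_or_anc_par with e | h4
    · exact hne e.symm
    · have := hinv.anc_mem_visited ht.1 (hinv.par_mem u (by simp [hu]) h1) h4
      exact (List.nodup_append.1 hinv.nodup).2.2 v this v hv rfl
  · have := dfsPos_lt_of_seen ht hi (a := v) (b := u)
      (h.trans (List.sublist_append_right _ _))
    omega

theorem SameSCC.refl {m : ℕ} (E : Fin m → Fin m → Prop) (u : Fin m) : SameSCC E u u :=
  ⟨.refl, .refl⟩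

theorem SameSCC.symm {m : ℕ} {E : Fin m → Fin m → Prop} {u v : Fin m} (h : SameSCC E u v) :
    SameSCC E v u :=
  ⟨h.2, h.1⟩

theorem SameSCC.trans {m : ℕ} {E : Fin m → Fin m → Prop} {u v w : Fin m} (h : SameSCC E u v)
    (h' : SameSCC E v w) : SameSCC E u w :=
  ⟨h.1.trans h'.1, h'.2.trans h.2⟩

/-- Inside a strongly connected component, some edge leaves any given set of vertices that
contains one vertex of the component but not another. -/
theorem SameSCC.exists_exit {m : ℕ} {E : Fin m → Fin m → Prop} {w a c : Fin m}
    (ha : SameSCC E w a) (hc : SameSCC E w c) {P : Fin m → Prop} (hPa : P a) (hPc : ¬ P c) :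
    ∃ u v, E u v ∧ SameSCC E w u ∧ SameSCC E w v ∧ P u ∧ ¬ P v := by
  have key : ∀ x, Relation.ReflTransGen E a x → ¬ P x → ∃ u v, Relation.ReflTransGen E a u ∧
      E u v ∧ Relation.ReflTransGen E v x ∧ P u ∧ ¬ P v := by
    intro x hx
    induction hx with
    | refl => exact fun h => absurd hPa h
    | @tail y z hy hyz ih =>
      intro hz
      by_cases hPy : P y
      · exact ⟨y, z, hy, hyz, .refl, hPy, hz⟩
      · obtain ⟨u, v, h1, h2, h3, h4, h5⟩ := ih hPy
        exact ⟨u, v, h1, h2, h3.tail hyz, h4, h5⟩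
  obtain ⟨u, v, h1, h2, h3, h4, h5⟩ := key c (ha.symm.trans hc).1 hPc
  refine ⟨u, v, h2, ⟨ha.1.trans h1, ?_⟩, ⟨(ha.1.trans h1).tail h2, h3.trans hc.2⟩, h4, h5⟩
  exact (Relation.ReflTransGen.head h2 h3).trans hc.2

/-- The configurations of additional edges charged by the law of `X_m`. -/
structure Admissible {m : ℕ} (par : Fin m → Fin m) (r : Fin m)
    (b s : Fin m → Fin m → Bool) : Prop where
  tree : IsPTree par r
  back : ∀ u w, b u w = true → dfsPos par r w < dfsPos par r u
  surp : ∀ u w, s u w = true → (u, w) ∈ permitted par r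

theorem dfsPos_lt_of_permitted {m : ℕ} {par : Fin m → Fin m} {r u v : Fin m}
    (h : (u, v) ∈ permitted par r) : dfsPos par r u < dfsPos par r v := by
  simp only [permitted, mem_filter] at h
  exact h.2.2.1

section

variable {m : ℕ} {par : Fin m → Fin m} {r : Fin m} {b s : Fin m → Fin m → Bool}

theorem Admissible.edge_ne (h : Admissible par r b s) {u v : Fin m} (e : edgeX par r b s u v) :
    u ≠ v := by
  rintro rfl
  rcases e with ⟨h1, h2⟩ | h1 | h1
  · have := dfsPos_par_lt h.tree h1
    rw [h2] at this
    exact lt_irrefl _ this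
  · exact lt_irrefl _ (h.back _ _ h1)
  · exact lt_irrefl _ (dfsPos_lt_of_permitted (h.surp _ _ h1))

theorem Admissible.lt_or_back (h : Admissible par r b s) {u v : Fin m}
    (e : edgeX par r b s u v) : dfsPos par r u < dfsPos par r v ∨ b u v = true := by
  rcases e with ⟨h1, rfl⟩ | h1 | h1
  · exact .inl (dfsPos_par_lt h.tree h1)
  · exact .inr h1
  · exact .inl (dfsPos_lt_of_permitted (h.surp _ _ h1))

/-- The first vertex, in planar order, of a nontrivial strongly connected component is the
head of a back edge of this component. -/
theorem Admissible.exists_first (h : Admissible par r b s) {w w' : Fin m}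
    (hw : SameSCC (edgeX par r b s) w w') (hne : w ≠ w') :
    ∃ z x, SameSCC (edgeX par r b s) w z ∧ SameSCC (edgeX par r b s) w x ∧ b x z = true ∧
      ∀ v, SameSCC (edgeX par r b s) w v → dfsPos par r z ≤ dfsPos par r v := by
  obtain ⟨z, hz, hmin⟩ := (univ.filter (SameSCC (edgeX par r b s) w)).exists_min_image
    (dfsPos par r) ⟨w, by simp [SameSCC.refl]⟩
  simp only [mem_filter, mem_univ, true_and] at hz hmin
  obtain ⟨a, ha, haz⟩ : ∃ a, SameSCC (edgeX par r b s) w a ∧ a ≠ z := by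
    by_cases e : w = z
    · exact ⟨w', hw, fun e' => hne (e.trans e'.symm)⟩
    · exact ⟨w, SameSCC.refl _ _, e⟩
  obtain ⟨x, v, hxv, hx, hv, -, hvz⟩ := ha.exists_exit hz (P := fun y => y ≠ z) haz (by simp)
  have hvz : v = z := by simpa using hvz
  subst hvz
  refine ⟨v, x, hz, hx, ?_, hmin⟩
  rcases h.lt_or_back hxv with h' | h'
  · have := hmin x hx
    omega
  · exact h'

/-- An edge leaving a subtree goes before the root of the subtree or is a surplus edge. -/
theorem Admissible.exit (h : Admissible par r b s) {z u v : Fin m}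
    (e : edgeX par r b s u v) (hu : Anc par z u) (hv : ¬ Anc par z v) :
    (b u v = true ∧ dfsPos par r v < dfsPos par r z) ∨ s u v = true := by
  rcases e with ⟨h1, rfl⟩ | h1 | h1
  · exact absurd (hu.trans (anc_par v)) hv
  · exact .inl ⟨h1, dfsPos_lt_of_exit h.tree hu hv (h.back _ _ h1)⟩
  · exact .inr h1

/-- A strongly connected component with a surplus edge requires a back edge and a surplus edge
which are suitably placed. -/
theorem Admissible.of_surplus_mem (h : Admissible par r b s) {a c : Fin m} (hac : s a c = true)
    (hS : SameSCC (edgeX par r b s) a c) :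
    ∃ x z u v, b x z = true ∧ s u v = true ∧ (Anc par z x ∨ Anc par z u) := by
  have hne : a ≠ c := h.edge_ne (Or.inr (Or.inr hac))
  obtain ⟨z, x, hz, hx, hb, hmin⟩ := h.exists_first hS hne
  by_cases hzx : Anc par z x
  · exact ⟨x, z, a, c, hb, hac, .inl hzx⟩
  · obtain ⟨u, v, huv, hu, hv, hzu, hzv⟩ := hz.exists_exit hx (P := Anc par z) (Anc.refl z) hzx
    rcases h.exit huv hzu hzv with ⟨-, h'⟩ | h'
    · have := hmin v hv
      omega
    · exact ⟨x, z, u, v, hb, h', .inr hzu⟩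

/-- The structure of a strongly connected component without surplus edges. -/
theorem Admissible.scc_cases (h : Admissible par r b s) (w : Fin m)
    (hns : ∀ a c, s a c = true → ¬ SameSCC (edgeX par r b s) a c) :
    (∃ x y x' y', b x y = true ∧ b x' y' = true ∧ (x, y) ≠ (x', y') ∧ Anc par y x ∧
      Anc par y' x) ∨
    ((sccEdges (edgeX par r b s) w).ncard ≤ {v | SameSCC (edgeX par r b s) w v}.ncard ∧
      {v | SameSCC (edgeX par r b s) w v}.ncard ≤ treeHeight par r + 1) := by
  set E := edgeX par r b s with hE
  have hns' : ∀ a c, SameSCC E w a → SameSCC E w c → s a c = true → False :=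
    fun a c h1 h2 h3 => hns a c h3 (h1.symm.trans h2)
  by_cases htriv : ∀ w', SameSCC E w w' → w = w'
  · right
    have h1 : sccEdges E w = ∅ := by
      ext ⟨a, c⟩
      simp only [sccEdges, Set.mem_ofPred_eq, Set.mem_empty_iff_false, iff_false, not_and]
      intro e h1 h2
      exact h.edge_ne e ((htriv a h1).symm.trans (htriv c h2))
    have h2 : {v | SameSCC E w v} = {w} := by
      ext v
      exact ⟨fun hv => (htriv v hv).symm, fun hv => hv ▸ SameSCC.refl E w⟩
    rw [h1, h2]
    simp
  push Not at htriv
  obtain ⟨w', hw', hne⟩ := htriv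
  obtain ⟨z, x, hz, hx, hb, hmin⟩ := h.exists_first hw' hne
  have hsub : ∀ v, SameSCC E w v → Anc par z v := by
    intro v hv
    by_contra hzv
    obtain ⟨u, v', huv, hu, hv', hzu, hzv'⟩ := hz.exists_exit hv (P := Anc par z) (Anc.refl z) hzv
    rcases h.exit huv hzu hzv' with ⟨-, h'⟩ | h'
    · have := hmin v' hv'
      omega
    · exact hns' _ _ hu hv' h'
  have hEz : ∀ a, SameSCC E w a → E a z → b a z = true := by
    intro a ha e
    rcases h.lt_or_back e with h' | h'
    · have := hmin a ha
      omega
    · exact h'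
  by_cases hone : ∀ a c, SameSCC E w a → SameSCC E w c → b a c = true → (a, c) = (x, z)
  · right
    have hanc : ∀ v, SameSCC E w v → Anc par v x := by
      intro v hv
      by_contra hvx
      have hvz : ¬ Anc par v z := fun hvz =>
        hvx (hvz.trans (hsub x hx))
      obtain ⟨u, v', huv, hu, hv', hvu, hvv'⟩ := hv.exists_exit hz (P := Anc par v) (Anc.refl v) hvz
      rcases h.exit huv hvu hvv' with ⟨h', -⟩ | h'
      · have := hone u v' hu hv' h'
        simp only [Prod.mk.injEq] at this
        exact hvx (this.1 ▸ hvu)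
      · exact hns' _ _ hu hv' h'
    constructor
    · refine Set.ncard_le_ncard_of_injOn Prod.snd ?_ ?_ (Set.toFinite _)
      · rintro ⟨a, c⟩ ⟨-, -, hc⟩
        exact hc
      · rintro ⟨a, c⟩ ⟨e1, ha, hc⟩ ⟨a', c'⟩ ⟨e2, ha', hc'⟩ heq
        simp only at heq e1 e2 ha ha' hc hc'
        subst heq
        have key : ∀ a, SameSCC E w a → E a c → (c = z ∧ a = x) ∨ (c ≠ z ∧ par c = a) := by
          intro a ha e
          by_cases hcz : c = z
          · subst hcz
            have := hone a c ha hc (hEz a ha e)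
            simp only [Prod.mk.injEq] at this
            exact .inl ⟨rfl, this.1⟩
          · rcases e with ⟨-, e⟩ | e | e
            · exact .inr ⟨hcz, e⟩
            · have := hone a c ha hc e
              simp only [Prod.mk.injEq] at this
              exact absurd this.2 hcz
            · exact absurd e (fun e => hns' _ _ ha hc e)
        have h1 := key a ha e1
        have h2 := key a' ha' e2
        grind
    · have hcard : {v | SameSCC E w v} ⊆
          (((range (treeHeight par r + 1)).image (fun k => par^[k] x) : Finset (Fin m)) :
            Set (Fin m)) := by
        intro v hv
        simp only [coe_image, coe_range, Set.mem_image, Set.mem_Iio]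
        obtain ⟨k, hk⟩ := hanc v hv
        have hh : par^[hgt par r x] x = r := Nat.sInf_mem (h.tree.2 x)
        have hle : hgt par r x ≤ treeHeight par r := le_sup (f := hgt par r) (mem_univ x)
        rcases le_or_gt k (hgt par r x) with hk' | hk'
        · exact ⟨k, by omega, hk⟩
        · refine ⟨hgt par r x, by omega, ?_⟩
          have : k = (k - hgt par r x) + hgt par r x := by omega
          rw [← hk, this, Function.iterate_add_apply, hh,
            Function.iterate_fixed h.tree.1]
      calc _ ≤ Set.ncard (((range (treeHeight par r + 1)).image (fun k => par^[k] x) :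
            Finset (Fin m)) : Set (Fin m)) := Set.ncard_le_ncard hcard (Set.toFinite _)
        _ ≤ _ := by
            rw [Set.ncard_coe_finset]
            exact card_image_le.trans (by simp)
  · left
    push Not at hone
    obtain ⟨a, c, ha, hc, hac, hne'⟩ := hone
    set H := univ.filter (fun e : Fin m × Fin m => SameSCC E w e.1 ∧ SameSCC E w e.2 ∧
      b e.1 e.2 = true ∧ e ≠ (x, z)) with hH
    obtain ⟨⟨x', y'⟩, he, hemin⟩ := H.exists_min_image (fun e => dfsPos par r e.2)
      ⟨(a, c), by simpa [hH] using ⟨ha, hc, hac, by simpa using hne'⟩⟩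
    simp only [hH, mem_filter, mem_univ, true_and] at he hemin
    obtain ⟨hx', hy', hb', hne''⟩ := he
    refine ⟨x, z, x', y', hb, hb', hne''.symm, hsub x hx, ?_⟩
    by_contra hyx
    have hyz : ¬ Anc par y' z := fun hyz => hyx (hyz.trans (hsub x hx))
    obtain ⟨u, v, huv, hu, hv, hyu, hyv⟩ := hy'.exists_exit hz (P := Anc par y') (Anc.refl y') hyz
    rcases h.exit huv hyu hyv with ⟨h', hlt⟩ | h'
    · have := hemin (u, v) ⟨hu, hv, h', fun e => by
        simp only [Prod.mk.injEq] at e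
        exact hyx (e.1 ▸ hyu)⟩
      simp only at this
      omega
    · exact hns' _ _ hu hv h'

end

/-- The law of a random subset of `A` containing each element independently with
probability `p`. -/
noncomputable def bernW {m : ℕ} (p : ℝ) (A : Finset (Fin m × Fin m))
    (b : Fin m → Fin m → Bool) : ℝ :=
  if ∀ u w, b u w = true → (u, w) ∈ A then
    ∏ x ∈ A, (if b x.1 x.2 then p else 1 - p)
  else 0

theorem backW_eq_bernW {m : ℕ} (p : ℝ) (par : Fin m → Fin m) (r : Fin m) :
    backW p par r =
      bernW p (univ.filter (fun x : Fin m × Fin m => dfsPos par r x.2 < dfsPos par r x.1)) := by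
  ext b
  simp [backW, bernW]

theorem surpW_eq_bernW {m : ℕ} (p : ℝ) (par : Fin m → Fin m) (r : Fin m) :
    surpW p par r = bernW p (permitted par r) := rfl

theorem bernW_nonneg {m : ℕ} {p : ℝ} (h0 : 0 ≤ p) (h1 : p ≤ 1) (A : Finset (Fin m × Fin m))
    (b : Fin m → Fin m → Bool) : 0 ≤ bernW p A b := by
  unfold bernW
  split_ifs
  · exact prod_nonneg fun x _ => by split_ifs <;> linarith
  · exact le_rfl

theorem sum_prod_bool {m : ℕ} (F : Fin m × Fin m → Bool → ℝ) :
    ∑ b : Fin m → Fin m → Bool, ∏ x : Fin m × Fin m, F x (b x.1 x.2) =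
      ∏ x, (F x true + F x false) := by
  have h1 : ∀ x, F x true + F x false = ∑ c : Bool, F x c := fun x => by simp
  simp_rw [h1]
  rw [Finset.prod_univ_sum, Fintype.piFinset_univ]
  exact Fintype.sum_equiv (Equiv.curry (Fin m) (Fin m) Bool).symm _ _ (fun b => rfl)

theorem sum_bernW_mul {m : ℕ} (p : ℝ) (A E : Finset (Fin m × Fin m)) :
    ∑ b, bernW p A b * (if ∀ x ∈ E, b x.1 x.2 = true then 1 else 0) =
      if E ⊆ A then p ^ #E else 0 := by
  let F : Fin m × Fin m → Bool → ℝ := fun x c => (if x ∈ A then (if c then p else 1 - p)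
    else if c then 0 else 1) * (if x ∈ E then (if c then 1 else 0) else 1)
  have h1 : ∀ b : Fin m → Fin m → Bool,
      bernW p A b * (if ∀ x ∈ E, b x.1 x.2 = true then 1 else 0) =
      ∏ x : Fin m × Fin m, F x (b x.1 x.2) := by
    intro b
    simp only [F]
    rw [prod_mul_distrib]
    congr 1
    · unfold bernW
      split_ifs with h
      · rw [← prod_subset (subset_univ A)]
        · exact prod_congr rfl fun x hx => by simp [hx]
        · intro x _ hx
          have : b x.1 x.2 = false := by
            by_contra hb
            exact hx (h x.1 x.2 (by simpa using hb))
          simp [hx, this]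
      · push Not at h
        obtain ⟨u, w, hb, hA⟩ := h
        exact (prod_eq_zero (mem_univ (u, w)) (by simp [hb, hA])).symm
    · split_ifs with h
      · exact (prod_eq_one fun x _ => by
          by_cases hx : x ∈ E
          · simp [hx, h x hx]
          · simp [hx]).symm
      · push Not at h
        obtain ⟨x, hx, hb⟩ := h
        exact (prod_eq_zero (mem_univ x) (by simp [hx, hb])).symm
  refine (sum_congr rfl fun b _ => h1 b).trans ((sum_prod_bool F).trans ?_)
  by_cases h : E ⊆ A
  · rw [if_pos h, ← prod_const, ← prod_subset (subset_univ E)]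
    · exact prod_congr rfl fun x hx => by simp [F, hx, h hx]
    · intro x _ hx
      by_cases hA : x ∈ A <;> simp [F, hx, hA]
  · rw [if_neg h]
    rw [not_subset] at h
    obtain ⟨x, hx, hA⟩ := h
    exact prod_eq_zero (mem_univ x) (by simp [F, hx, hA])

theorem sum_bernW {m : ℕ} (p : ℝ) (A : Finset (Fin m × Fin m)) : ∑ b, bernW p A b = 1 := by
  simpa using sum_bernW_mul p A ∅

theorem sum_bernW_mul_le {m : ℕ} {p : ℝ} (h0 : 0 ≤ p) (A E : Finset (Fin m × Fin m)) :
    ∑ b, bernW p A b * (if ∀ x ∈ E, b x.1 x.2 = true then 1 else 0) ≤ p ^ #E := by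
  rw [sum_bernW_mul]
  split_ifs
  · exact le_rfl
  · positivity

/-- `par` is the parent map of a forest with vertex set `W ∪ R` and set of roots `R`; it is
extended by the identity outside of `W`. -/
def IsForest {N : ℕ} (W R : Finset (Fin N)) (par : Fin N → Fin N) : Prop :=
  (∀ v ∉ W, par v = v) ∧ ∀ v ∈ W, Reaches par R v

/-- The set of (parent maps of) forests with vertex set `W ∪ R` and set of roots `R`. -/
noncomputable def forests {N : ℕ} (W R : Finset (Fin N)) : Finset (Fin N → Fin N) :=
  univ.filter (IsForest W R)

theorem mem_forests {N : ℕ} {W R : Finset (Fin N)} {par : Fin N → Fin N} :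
    par ∈ forests W R ↔ IsForest W R par := by simp [forests]

theorem Reaches.mem_of_fixed {N : ℕ} {par : Fin N → Fin N} {R : Finset (Fin N)} {v : Fin N}
    (h : Reaches par R v) (hv : par v = v) : v ∈ R := by
  obtain ⟨k, hk⟩ := reaches_iff.1 h
  rwa [Function.iterate_fixed hv] at hk

theorem IsForest.reaches_par {N : ℕ} {W R : Finset (Fin N)} {par : Fin N → Fin N}
    (h : IsForest W R par) (hd : Disjoint W R) {v : Fin N} (hv : v ∈ W) :
    Reaches par R (par v) := by
  cases h.2 v hv with
  | base h' => exact absurd h' (disjoint_left.1 hd hv)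
  | step h' => exact h'

theorem IsForest.par_mem {N : ℕ} {W R : Finset (Fin N)} {par : Fin N → Fin N}
    (h : IsForest W R par) (hd : Disjoint W R) {v : Fin N} (hv : v ∈ W) : par v ∈ W ∪ R := by
  rw [mem_union]
  by_contra! hc
  exact hc.2 ((h.reaches_par hd hv).mem_of_fixed (h.1 _ hc.1))

theorem forests_empty_left {N : ℕ} (R : Finset (Fin N)) : forests ∅ R = {id} := by
  ext par
  simp only [mem_forests, IsForest, mem_singleton, funext_iff, id]
  simp

theorem forests_empty_right {N : ℕ} {W : Finset (Fin N)} (hW : W.Nonempty) :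
    forests W ∅ = ∅ := by
  rw [eq_empty_iff_forall_notMem]
  intro par h
  obtain ⟨v, hv⟩ := hW
  obtain ⟨k, hk⟩ := reaches_iff.1 ((mem_forests.1 h).2 v hv)
  simp at hk

/-- Removing the roots of a forest. -/
theorem IsForest.remove {N : ℕ} {W R A : Finset (Fin N)} {par : Fin N → Fin N}
    (h : IsForest W R par) (hd : Disjoint W R) (hA : W.filter (fun v => par v ∈ R) = A) :
    IsForest (W \ A) A (fun v => if v ∈ W \ A then par v else v) := by
  refine ⟨fun v hv => if_neg hv, fun v hv => ?_⟩
  have hv' : v ∈ W := (mem_sdiff.1 hv).1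
  have hr := h.2 v hv'
  clear hv
  induction hr with
  | base h' => exact absurd h' (disjoint_left.1 hd hv')
  | @step v h' ih =>
    by_cases hvA : v ∈ A
    · exact .base hvA
    · have h1 : par v ∉ R := fun h1 => hvA (hA ▸ mem_filter.2 ⟨hv', h1⟩)
      have h2 : par v ∈ W := by simpa [h1] using h.par_mem hd hv'
      have h3 : v ∈ W \ A := mem_sdiff.2 ⟨hv', hvA⟩
      refine .step ?_
      simp only [h3, if_true]
      exact ih h2

/-- Attaching the roots of a forest to new roots. -/
theorem IsForest.attach {N : ℕ} {W R A : Finset (Fin N)} {par' g : Fin N → Fin N}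
    (hA : A ⊆ W) (h : IsForest (W \ A) A par') (hg : ∀ v ∈ A, g v ∈ R) :
    IsForest W R (fun v => if v ∈ A then g v else par' v) := by
  refine ⟨fun v hv => ?_, fun v hv => ?_⟩
  · have : v ∉ A := fun h' => hv (hA h')
    simp only [this, if_false]
    exact h.1 v (by simp [hv])
  · have base : ∀ v ∈ A, Reaches (fun v => if v ∈ A then g v else par' v) R v := fun v hv =>
      .step (.base (by simpa [hv] using hg v hv))
    by_cases hvA : v ∈ A
    · exact base v hvA
    · have := h.2 v (by simp [hv, hvA])
      clear hv hvA
      induction this with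
      | base h => exact base _ h
      | @step v h' ih =>
        by_cases hvA : v ∈ A
        · exact base v hvA
        · exact .step (by simpa [hvA] using ih)

/-- The weight of a forest: the product over non-root vertices of the weights of their parents. -/
noncomputable def forestWeight {N : ℕ} (x : Fin N → ℝ) (W R : Finset (Fin N)) : ℝ :=
  ∑ par ∈ forests W R, ∏ v ∈ W, x (par v)

theorem forestWeight_eq_sum {N : ℕ} (x : Fin N → ℝ) {W R : Finset (Fin N)} (hd : Disjoint W R) :
    forestWeight x W R =
      ∑ A ∈ W.powerset, (∑ v ∈ R, x v) ^ #A * forestWeight x (W \ A) A := by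
  unfold forestWeight
  rw [← sum_fiberwise_of_maps_to (g := fun par => W.filter (fun v => par v ∈ R))
    (t := W.powerset) (fun par _ => mem_powerset.2 (filter_subset _ _))]
  refine sum_congr rfl fun A hA => ?_
  rw [mem_powerset] at hA
  let P : Fin N → Finset (Fin N) := fun v => if v ∈ A then R else {v}
  have h1 : (∑ v ∈ R, x v) ^ #A =
      ∑ g ∈ Fintype.piFinset P, ∏ v ∈ A, x (g v) := by
    have := prod_univ_sum P (fun v j => if v ∈ A then x j else 1)
    have h2 : ∀ g : Fin N → Fin N, ∏ v, (if v ∈ A then x (g v) else 1) = ∏ v ∈ A, x (g v) := by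
      intro g
      rw [prod_ite_mem, univ_inter]
    simp_rw [h2] at this
    rw [← this, ← prod_const, ← prod_subset (subset_univ A)]
    · exact prod_congr rfl fun v hv => by simp [P, hv]
    · intro v _ hv
      simp [P, hv]
  rw [h1, sum_mul_sum, ← sum_product']
  refine sum_nbij' (fun par => (fun v => if v ∈ A then par v else v,
      fun v => if v ∈ W \ A then par v else v))
    (fun q v => if v ∈ A then q.1 v else q.2 v) ?_ ?_ ?_ ?_ ?_
  · intro par hpar
    rw [mem_filter, mem_forests] at hpar
    rw [mem_product, mem_forests, Fintype.mem_piFinset]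
    refine ⟨fun v => ?_, hpar.1.remove hd hpar.2⟩
    by_cases hv : v ∈ A
    · simp only [hv, P, if_true]
      rw [← hpar.2, mem_filter] at hv
      exact hv.2
    · simp [hv, P]
  · rintro ⟨g, par'⟩ hq
    rw [mem_product, mem_forests, Fintype.mem_piFinset] at hq
    have hg : ∀ v ∈ A, g v ∈ R := fun v hv => by simpa [P, hv] using hq.1 v
    rw [mem_filter, mem_forests]
    refine ⟨hq.2.attach hA hg, ?_⟩
    ext v
    simp only [mem_filter]
    constructor
    · rintro ⟨hvW, hv⟩
      by_contra hvA
      rw [if_neg hvA] at hv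
      have := hq.2.par_mem sdiff_disjoint (v := v) (by simp [hvW, hvA])
      rw [sdiff_union_of_subset hA] at this
      exact disjoint_left.1 hd this hv
    · intro hv
      exact ⟨hA hv, by simpa [hv] using hg v hv⟩
  · intro par hpar
    rw [mem_filter, mem_forests] at hpar
    ext1 v
    by_cases hv : v ∈ A
    · simp [hv]
    · by_cases hW : v ∈ W
      · simp [hv, hW]
      · simp [hv, hW, hpar.1.1 v hW]
  · rintro ⟨g, par'⟩ hq
    rw [mem_product, mem_forests, Fintype.mem_piFinset] at hq
    ext1
    · funext v
      by_cases hv : v ∈ A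
      · simp [hv]
      · have := hq.1 v
        simp only [P, hv, if_false, mem_singleton] at this
        simp [hv, this]
    · funext v
      by_cases hv : v ∈ W \ A
      · simp only [hv, if_true]
        simp [(mem_sdiff.1 hv).2]
      · simp only [hv, if_false]
        exact (hq.2.1 v hv).symm
  · intro par hpar
    rw [← prod_sdiff hA, mul_comm]
    congr 1
    · exact prod_congr rfl fun v hv => by simp [hv]
    · exact prod_congr rfl fun v hv => by simp only [if_pos hv]

theorem sum_powerset_mul_sum {ι : Type*} (x : ι → ℝ) (y z : ℝ) (W : Finset ι) :
    (∑ A ∈ W.powerset, (∑ v ∈ A, x v) * (y ^ #A * z ^ (#W - #A))) * (y + z) =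
      (∑ v ∈ W, x v) * y * (y + z) ^ #W := by
  induction W using Finset.induction_on with
  | empty => simp
  | @insert a W ha ih =>
    have hA : ∀ A ∈ W.powerset, #A ≤ #W ∧ a ∉ A := fun A hA =>
      ⟨card_le_card (mem_powerset.1 hA), fun h => ha (mem_powerset.1 hA h)⟩
    rw [sum_powerset_insert ha, card_insert_of_notMem ha, sum_insert ha]
    have h1 : ∑ A ∈ W.powerset, (∑ v ∈ A, x v) * (y ^ #A * z ^ (#W + 1 - #A)) =
        z * ∑ A ∈ W.powerset, (∑ v ∈ A, x v) * (y ^ #A * z ^ (#W - #A)) := by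
      rw [mul_sum]
      refine sum_congr rfl fun A h => ?_
      rw [Nat.sub_add_comm (hA A h).1, pow_succ]
      ring
    have h2 : ∑ A ∈ W.powerset, (∑ v ∈ insert a A, x v) *
          (y ^ #(insert a A) * z ^ (#W + 1 - #(insert a A))) =
        y * (∑ A ∈ W.powerset, (∑ v ∈ A, x v) * (y ^ #A * z ^ (#W - #A))) +
          y * x a * (y + z) ^ #W := by
      rw [← sum_pow_mul_eq_add_pow, mul_sum, mul_sum, ← sum_add_distrib]
      refine sum_congr rfl fun A h => ?_
      rw [sum_insert (hA A h).2, card_insert_of_notMem (hA A h).2, Nat.add_sub_add_right]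
      ring
    rw [h1, h2]
    linear_combination (y + z) * ih

/-- The weighted Cayley formula. -/
theorem forestWeight_mul {N : ℕ} {x : Fin N → ℝ} (hx : ∀ v, 0 < x v) {W R : Finset (Fin N)}
    (hd : Disjoint W R) :
    forestWeight x W R * (∑ v ∈ W, x v + ∑ v ∈ R, x v) =
      (∑ v ∈ R, x v) * (∑ v ∈ W, x v + ∑ v ∈ R, x v) ^ #W := by
  induction hn : #W using Nat.strong_induction_on generalizing W R with
  | _ n ih =>
    rcases W.eq_empty_or_nonempty with rfl | hW
    · obtain rfl : n = 0 := by simpa using hn.symm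
      simp [forestWeight, forests_empty_left]
    have hpos : 0 < ∑ v ∈ W, x v := sum_pos (fun v _ => hx v) hW
    have h1 : forestWeight x W R * ∑ v ∈ W, x v =
        ∑ A ∈ W.powerset, (∑ v ∈ A, x v) *
          ((∑ v ∈ R, x v) ^ #A * (∑ v ∈ W, x v) ^ (#W - #A)) := by
      rw [forestWeight_eq_sum x hd, sum_mul]
      refine sum_congr rfl fun A hA => ?_
      rw [mem_powerset] at hA
      rw [mul_assoc, ← card_sdiff_of_subset hA]
      rcases A.eq_empty_or_nonempty with rfl | hA'
      · simp [forestWeight, forests_empty_right hW]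
      · have := ih #(W \ A) (by
          rw [card_sdiff_of_subset hA]
          have := card_le_card hA
          have := hA'.card_pos
          omega) (W := W \ A) (R := A) sdiff_disjoint rfl
        rw [sum_sdiff hA] at this
        rw [this]
        ring
    have h2 := sum_powerset_mul_sum x (∑ v ∈ R, x v) (∑ v ∈ W, x v) W
    rw [← h1] at h2
    rw [hn] at h2
    refine mul_right_cancel₀ hpos.ne' ?_
    rw [add_comm (∑ v ∈ W, x v)]
    linear_combination h2

theorem card_forests_mul {N : ℕ} {W R : Finset (Fin N)} (hd : Disjoint W R) :
    (#(forests W R) : ℝ) * (#W + #R) = #R * ((#W + #R : ℝ)) ^ #W := by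
  simpa [forestWeight] using forestWeight_mul (x := fun _ => (1 : ℝ)) (by simp) hd

theorem Reaches.iterate_hgt {N : ℕ} {T : Fin N → Fin N} {r u : Fin N} (h : Reaches T {r} u) :
    T^[hgt T r u] u = r := by
  have : {k : ℕ | T^[k] u = r}.Nonempty := by
    obtain ⟨k, hk⟩ := reaches_iff.1 h
    exact ⟨k, by simpa using hk⟩
  exact Nat.sInf_mem this

theorem iterate_ne_of_lt_hgt {N : ℕ} {T : Fin N → Fin N} {r u : Fin N} {i : ℕ}
    (hi : i < hgt T r u) : T^[i] u ≠ r := Nat.notMem_of_lt_sInf hi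

theorem hgt_le {N : ℕ} {T : Fin N → Fin N} {r u : Fin N} {i : ℕ} (hi : T^[i] u = r) :
    hgt T r u ≤ i := Nat.sInf_le hi

theorem Reaches.iterate_ne {N : ℕ} {T : Fin N → Fin N} {r u : Fin N} (h : Reaches T {r} u)
    {i j : ℕ} (hij : i < j) (hj : j ≤ hgt T r u) : T^[i] u ≠ T^[j] u := by
  intro e
  refine iterate_ne_of_lt_hgt (T := T) (r := r) (u := u) (i := (hgt T r u - j) + i)
    (by omega) ?_
  rw [Function.iterate_add_apply, e, ← Function.iterate_add_apply,
    Nat.sub_add_cancel hj, h.iterate_hgt]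

theorem IsForest.reaches_of_mem {N : ℕ} {W R : Finset (Fin N)} {T : Fin N → Fin N}
    (hT : IsForest W R T) {u : Fin N} (hu : u ∈ W ∪ R) : Reaches T R u := by
  rcases mem_union.1 hu with h | h
  · exact hT.2 u h
  · exact .base h

theorem IsForest.iterate_mem {N : ℕ} {W : Finset (Fin N)} {r : Fin N} {T : Fin N → Fin N}
    (hT : IsForest W {r} T) {u : Fin N} (hu : Reaches T {r} u) {i : ℕ} (hi : i < hgt T r u) :
    T^[i] u ∈ W := by
  by_contra hc
  have h1 := hT.1 _ hc
  have h2 := hu.iterate_hgt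
  have h3 : hgt T r u = (hgt T r u - i) + i := by omega
  rw [h3, Function.iterate_add_apply, Function.iterate_fixed h1] at h2
  exact iterate_ne_of_lt_hgt hi h2

/-- The path from `u` to the root, without the root. -/
def spine {N : ℕ} (T : Fin N → Fin N) (u : Fin N) (k : ℕ) : Fin k → Fin N :=
  fun i => T^[i] u

theorem anc_iff_mem_spine {N : ℕ} {T : Fin N → Fin N} {r u y : Fin N} (hr : T r = r)
    (hu : Reaches T {r} u) :
    Anc T y u ↔ y ∈ insert r (univ.image (spine T u (hgt T r u))) := by
  simp only [mem_insert, mem_image, mem_univ, true_and, spine]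
  constructor
  · rintro ⟨i, rfl⟩
    by_cases hi : i < hgt T r u
    · exact .inr ⟨⟨i, hi⟩, rfl⟩
    · left
      have h3 : i = (i - hgt T r u) + hgt T r u := by omega
      rw [h3, Function.iterate_add_apply, hu.iterate_hgt, Function.iterate_fixed hr]
  · rintro (rfl | ⟨i, rfl⟩)
    · exact ⟨_, hu.iterate_hgt⟩
    · exact ⟨i, rfl⟩

theorem Reaches.spine_injective {N : ℕ} {T : Fin N → Fin N} {r u : Fin N}
    (h : Reaches T {r} u) : Function.Injective (spine T u (hgt T r u)) := by
  intro i j e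
  by_contra hij
  rcases lt_or_gt_of_ne hij with hij | hij
  · exact h.iterate_ne (i := i) (j := j) hij j.2.le e
  · exact h.iterate_ne (i := j) (j := i) hij i.2.le e.symm

/-- Cutting a forest along a set of vertices which contains, with each vertex, its parent. -/
theorem IsForest.cut {N : ℕ} {W R B : Finset (Fin N)} {T : Fin N → Fin N}
    (hT : IsForest W R T) :
    IsForest (W \ B) (R ∪ B) (fun v => if v ∈ B then v else T v) := by
  refine ⟨fun v hv => ?_, fun v hv => ?_⟩
  · by_cases hB : v ∈ B
    · simp [hB]
    · simp only [hB, if_false]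
      exact hT.1 v fun h => hv (mem_sdiff.2 ⟨h, hB⟩)
  · have hv' : Reaches T R v := hT.2 v (mem_sdiff.1 hv).1
    clear hv
    induction hv' with
    | base h => exact .base (mem_union_left _ h)
    | @step v h ih =>
      by_cases hB : v ∈ B
      · exact .base (mem_union_right _ hB)
      · exact .step (by simpa [hB] using ih)

/-- The vertices which are not ancestors of `u`, but whose parent is a strict ancestor of `u`. -/
noncomputable def spineChildren {N : ℕ} (W : Finset (Fin N)) (T : Fin N → Fin N) (u : Fin N) :
    Finset (Fin N) :=
  W.filter (fun v => ¬ Anc T v u ∧ Anc T (T v) u ∧ T v ≠ u)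

/-- The vertex of a tree from which the path `e` to the root `r` starts. -/
noncomputable def spineTop {N k : ℕ} (r : Fin N) (e : Fin k → Fin N) : Fin N :=
  if h : 0 < k then e ⟨0, h⟩ else r

theorem spineTop_spine {N : ℕ} {T : Fin N → Fin N} {r u : Fin N} (h : Reaches T {r} u) :
    spineTop r (spine T u (hgt T r u)) = u := by
  unfold spineTop
  split_ifs with h0
  · rfl
  · have := h.iterate_hgt
    obtain h0 : hgt T r u = 0 := by omega
    rw [h0] at this
    exact this.symm

/-- The weight used to count the children of a path. -/
noncomputable def spineWt {N k : ℕ} (x : ℝ) (r : Fin N) (e : Fin k → Fin N) (y : Fin N) : ℝ :=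
  if y ∈ insert r (univ.image e) ∧ y ≠ spineTop r e then x else 1

theorem sum_spineWt {N k : ℕ} (x : ℝ) {W : Finset (Fin N)} {r : Fin N} (hr : r ∉ W)
    {e : Fin k → Fin N} (he : Function.Injective e) (heW : ∀ i, e i ∈ W) :
    ∑ y ∈ insert r (univ.image e), spineWt x r e y = k * x + 1 := by
  have hcard : #(insert r (univ.image e)) = k + 1 := by
    rw [card_insert_of_notMem, card_image_of_injective _ he, card_univ, Fintype.card_fin]
    simp only [mem_image, mem_univ, true_and, not_exists]
    exact fun i h => hr (h ▸ heW i)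
  have htop : spineTop r e ∈ insert r (univ.image e) := by
    unfold spineTop
    split_ifs with h
    · exact mem_insert_of_mem (mem_image_of_mem _ (mem_univ _))
    · exact mem_insert_self _ _
  rw [← add_sum_erase _ _ htop, sum_congr rfl (g := fun _ => x), sum_const,
    card_erase_of_mem htop, hcard, nsmul_eq_mul]
  · simp [spineWt]; ring
  · intro y hy
    rw [mem_erase] at hy
    exact if_pos ⟨hy.2, hy.1⟩

theorem sum_spineWt_compl {N k : ℕ} (x : ℝ) {W : Finset (Fin N)} {r : Fin N} (hr : r ∉ W)
    {e : Fin k → Fin N} (he : Function.Injective e) (heW : ∀ i, e i ∈ W) :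
    ∑ y ∈ W \ univ.image e, spineWt x r e y = #W - k := by
  have hsub : univ.image e ⊆ W := by
    intro y hy
    obtain ⟨i, -, rfl⟩ := mem_image.1 hy
    exact heW i
  have hk : #(univ.image e) = k := by
    rw [card_image_of_injective _ he, card_univ, Fintype.card_fin]
  rw [sum_congr rfl (g := fun _ => 1), sum_const, card_sdiff_of_subset hsub, nsmul_eq_mul,
    mul_one, Nat.cast_sub (card_le_card hsub), hk]
  intro y hy
  rw [mem_sdiff] at hy
  refine if_neg fun h => ?_
  rcases mem_insert.1 h.1 with rfl | h
  · exact hr hy.1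
  · exact hy.2 h

/-- The vertices of height `k` in forests. -/
noncomputable def levelPairs {N : ℕ} (W : Finset (Fin N)) (r : Fin N) (k : ℕ) :
    Finset ((Fin N → Fin N) × Fin N) :=
  (forests W {r} ×ˢ insert r W).filter (fun q => hgt q.1 r q.2 = k)

/-- Injective sequences in `W`. -/
noncomputable def injSeqs {N : ℕ} (W : Finset (Fin N)) (k : ℕ) : Finset (Fin k → Fin N) :=
  univ.filter (fun e => Function.Injective e ∧ ∀ i, e i ∈ W)

theorem card_injSeqs {N : ℕ} (W : Finset (Fin N)) (k : ℕ) :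
    #(injSeqs W k) = (#W).descFactorial k := by
  have := Fintype.card_embedding_eq (α := Fin k) (β := W)
  rw [Fintype.card_fin, Fintype.card_coe] at this
  rw [← this, ← card_univ]
  symm
  refine card_bij (fun f _ i => (f i : Fin N)) ?_ ?_ ?_
  · intro f _
    exact mem_filter.2 ⟨mem_univ _, fun i j h => f.injective (Subtype.ext h), fun i => (f i).2⟩
  · intro f _ g _ h
    ext i
    exact congrArg Fin.val (congrFun h i)
  · intro e he
    obtain ⟨-, he1, he2⟩ := mem_filter.1 he
    exact ⟨⟨fun i => ⟨e i, he2 i⟩, fun i j h => he1 (congrArg Subtype.val h)⟩, mem_univ _, rfl⟩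

theorem levelPairs_spec {N : ℕ} {W : Finset (Fin N)} {r : Fin N} {k : ℕ}
    {q : (Fin N → Fin N) × Fin N} (hq : q ∈ levelPairs W r k) :
    IsForest W {r} q.1 ∧ Reaches q.1 {r} q.2 ∧ hgt q.1 r q.2 = k := by
  rw [levelPairs, mem_filter, mem_product, mem_forests] at hq
  exact ⟨hq.1.1, hq.1.1.reaches_of_mem (by simpa [or_comm] using hq.1.2), hq.2⟩

/-- The path of a marked vertex, and the forest obtained by cutting along this path. -/
noncomputable def spineCut {N : ℕ} (k : ℕ) (q : (Fin N → Fin N) × Fin N) :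
    (_ : Fin k → Fin N) × (Fin N → Fin N) :=
  ⟨spine q.1 q.2 k, fun v => if v ∈ univ.image (spine q.1 q.2 k) then v else q.1 v⟩

theorem spineCut_injOn {N : ℕ} {W : Finset (Fin N)} {r : Fin N} (k : ℕ) :
    Set.InjOn (spineCut k) (levelPairs W r k : Set ((Fin N → Fin N) × Fin N)) := by
  rintro ⟨T, u⟩ hq ⟨T', u'⟩ hq' h
  obtain ⟨hT, hu, hk⟩ := levelPairs_spec hq
  obtain ⟨hT', hu', hk'⟩ := levelPairs_spec hq'
  simp only at hT hu hk hT' hu' hk'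
  simp only [spineCut, Sigma.mk.injEq, heq_eq_eq] at h
  obtain ⟨h1, h2⟩ := h
  have huu : u = u' := by
    have e1 := spineTop_spine hu
    have e2 := spineTop_spine hu'
    rw [hk] at e1
    rw [hk', ← h1, e1] at e2
    exact e2
  subst huu
  have hit : ∀ i ≤ k, T^[i] u = T'^[i] u := by
    intro i hi
    rcases hi.lt_or_eq with hi | rfl
    · exact congrFun h1 ⟨i, hi⟩
    · have e1 := hu.iterate_hgt
      have e2 := hu'.iterate_hgt
      rw [hk] at e1
      rw [hk'] at e2
      rw [e1, e2]
  ext1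
  · funext v
    by_cases hv : v ∈ univ.image (spine T u k)
    · obtain ⟨i, -, rfl⟩ := mem_image.1 hv
      have e1 := hit (i + 1) i.2
      rw [Function.iterate_succ_apply', Function.iterate_succ_apply', ← hit i i.2.le] at e1
      exact e1
    · have := congrFun h2 v
      rw [← h1] at this
      simpa only [hv, if_false] using this
  · rfl

theorem spineCut_mem {N : ℕ} {W : Finset (Fin N)} {r : Fin N} {k : ℕ}
    {q : (Fin N → Fin N) × Fin N} (hq : q ∈ levelPairs W r k) :
    spineCut k q ∈ (injSeqs W k).sigma
      (fun e => forests (W \ univ.image e) (insert r (univ.image e))) := by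
  obtain ⟨hT, hu, rfl⟩ := levelPairs_spec hq
  rw [mem_sigma]
  refine ⟨mem_filter.2 ⟨mem_univ _, hu.spine_injective, fun i => hT.iterate_mem hu i.2⟩, ?_⟩
  rw [mem_forests, insert_eq]
  exact hT.cut

theorem prod_spineWt {N : ℕ} (x : ℝ) {W : Finset (Fin N)} {r : Fin N} (hr : r ∉ W) {k : ℕ}
    {q : (Fin N → Fin N) × Fin N} (hq : q ∈ levelPairs W r k) :
    ∏ v ∈ W \ univ.image (spineCut k q).1, spineWt x r (spineCut k q).1 ((spineCut k q).2 v) =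
      x ^ #(spineChildren W q.1 q.2) := by
  obtain ⟨hT, hu, rfl⟩ := levelPairs_spec hq
  obtain ⟨T, u⟩ := q
  simp only at hT hu ⊢
  have hanc : ∀ y, Anc T y u ↔ y ∈ insert r (univ.image (spine T u (hgt T r u))) := fun y =>
    anc_iff_mem_spine (hT.1 r hr) hu
  have hW : W \ univ.image (spine T u (hgt T r u)) = W.filter (fun v => ¬ Anc T v u) := by
    ext v
    rw [mem_sdiff, mem_filter, hanc, mem_insert, not_or]
    exact ⟨fun h => ⟨h.1, fun e => hr (e ▸ h.1), h.2⟩, fun h => ⟨h.1, h.2.2⟩⟩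
  have h1 : ∀ v ∈ W \ univ.image (spine T u (hgt T r u)),
      spineWt x r (spineCut (hgt T r u) (T, u)).1 ((spineCut (hgt T r u) (T, u)).2 v) =
        if Anc T (T v) u ∧ T v ≠ u then x else 1 := by
    intro v hv
    simp only [spineCut, (mem_sdiff.1 hv).2, if_false, spineWt, spineTop_spine hu, hanc]
  refine (prod_congr rfl h1).trans ?_
  rw [prod_ite, prod_const_one, mul_one, prod_const, hW, filter_filter]
  rfl

/-- The total weight of the vertices at height `k`, when a factor `x` is paid for every child
of the path to the root. -/
theorem sum_levelPairs_le {N : ℕ} {x : ℝ} (hx : 1 ≤ x) {W : Finset (Fin N)} {r : Fin N}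
    (hr : r ∉ W) (k : ℕ) :
    (∑ q ∈ levelPairs W r k, x ^ #(spineChildren W q.1 q.2)) * (#W + 1 + k * (x - 1)) ≤
      (#W).descFactorial k * ((k * x + 1) * (#W + 1 + k * (x - 1)) ^ (#W - k)) := by
  have hwt : ∀ (e : Fin k → Fin N) y, 0 < spineWt x r e y := fun e y => by
    unfold spineWt; split_ifs <;> linarith
  have h1 : ∑ q ∈ levelPairs W r k, x ^ #(spineChildren W q.1 q.2) ≤
      ∑ e ∈ injSeqs W k, forestWeight (spineWt x r e) (W \ univ.image e)
        (insert r (univ.image e)) := by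
    unfold forestWeight
    rw [← sum_congr rfl fun q hq => prod_spineWt x hr hq, sum_sigma']
    rw [← sum_image (f := fun z : (_ : Fin k → Fin N) × (Fin N → Fin N) =>
      ∏ v ∈ W \ univ.image z.1, spineWt x r z.1 (z.2 v)) (spineCut_injOn k)]
    refine sum_le_sum_of_subset_of_nonneg ?_ fun z _ _ => prod_nonneg fun v _ => (hwt _ _).le
    intro z hz
    obtain ⟨q, hq, rfl⟩ := mem_image.1 hz
    exact spineCut_mem hq
  have hX : (0 : ℝ) ≤ #W + 1 + k * (x - 1) := by
    have : (0 : ℝ) ≤ k * (x - 1) := mul_nonneg (by positivity) (by linarith)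
    positivity
  refine (mul_le_mul_of_nonneg_right h1 hX).trans (le_of_eq ?_)
  rw [sum_mul, ← card_injSeqs, ← nsmul_eq_mul #(injSeqs W k), ← sum_const]
  refine sum_congr rfl fun e he => ?_
  obtain ⟨-, he1, he2⟩ := mem_filter.1 he
  have hd : Disjoint (W \ univ.image e) (insert r (univ.image e)) := by
    rw [disjoint_insert_right]
    exact ⟨fun h => hr (mem_sdiff.1 h).1, sdiff_disjoint⟩
  have := forestWeight_mul (hwt e) hd
  rw [sum_spineWt x hr he1 he2, sum_spineWt_compl x hr he1 he2] at this
  have hsub : univ.image e ⊆ W := by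
    intro y hy
    obtain ⟨i, -, rfl⟩ := mem_image.1 hy
    exact he2 i
  rw [card_sdiff_of_subset hsub, card_image_of_injective _ he1, card_univ, Fintype.card_fin]
    at this
  have e1 : (#W : ℝ) - k + (k * x + 1) = #W + 1 + k * (x - 1) := by ring
  rw [e1] at this
  exact this

theorem descFactorial_le_exp (n k : ℕ) :
    (n.descFactorial k : ℝ) ≤ (n + 1) ^ k * Real.exp (-(k * (k + 1) / (2 * (n + 1)))) := by
  induction k with
  | zero => simp
  | succ k ih =>
    have h1 : ((n - k : ℕ) : ℝ) ≤ (n + 1) * Real.exp (-((k + 1) / (n + 1))) := by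
      rcases le_total k n with h | h
      · have := Real.add_one_le_exp (-(((k : ℝ) + 1) / (n + 1)))
        have h0 : (0 : ℝ) < n + 1 := by positivity
        calc ((n - k : ℕ) : ℝ) = (n + 1) * (-((k + 1) / (n + 1)) + 1) := by
              rw [Nat.cast_sub h]; field_simp; ring
          _ ≤ _ := mul_le_mul_of_nonneg_left this h0.le
      · rw [Nat.sub_eq_zero_of_le h, Nat.cast_zero]
        positivity
    rw [Nat.descFactorial_succ, Nat.cast_mul]
    refine (mul_le_mul h1 ih (by positivity) (by positivity)).trans (le_of_eq ?_)
    have h2 : -((k + 1 : ℕ) * ((k + 1 : ℕ) + 1) / (2 * ((n : ℝ) + 1))) =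
        -((k + 1) / (n + 1)) + -(k * (k + 1) / (2 * (n + 1))) := by
      push_cast
      field_simp
      ring
    rw [h2, Real.exp_add, pow_succ]
    ring

theorem card_trees_mul {N : ℕ} {W : Finset (Fin N)} {r : Fin N} (hr : r ∉ W) :
    (#(forests W {r}) : ℝ) * (#W + 1) = (#W + 1 : ℝ) ^ #W := by
  simpa using card_forests_mul (W := W) (R := {r}) (by simpa using hr)

theorem sum_levelPairs_le_exp {N : ℕ} {x : ℝ} (hx : 1 ≤ x) {W : Finset (Fin N)} {r : Fin N}
    (hr : r ∉ W) (k : ℕ) :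
    ∑ q ∈ levelPairs W r k, x ^ #(spineChildren W q.1 q.2) ≤
      #(forests W {r}) * ((k * x + 1) *
        Real.exp (-(k * (k + 1) / (2 * (#W + 1))) + k * (x - 1))) := by
  have hS : 0 ≤ ∑ q ∈ levelPairs W r k, x ^ #(spineChildren W q.1 q.2) :=
    sum_nonneg fun q _ => by positivity
  have hkx : (0 : ℝ) ≤ k * (x - 1) := mul_nonneg (by positivity) (by linarith)
  have h0 : (0 : ℝ) < #W + 1 := by positivity
  have hm := sum_levelPairs_le hx hr k
  refine le_of_mul_le_mul_right ?_ h0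
  refine (mul_le_mul_of_nonneg_left (by linarith) hS).trans (hm.trans ?_)
  rcases lt_or_ge #W k with hk | hk
  · rw [Nat.descFactorial_of_lt hk]
    simp only [Nat.cast_zero, zero_mul]
    positivity
  have h1 : (#W + 1 + k * (x - 1)) ^ (#W - k) ≤
      (#W + 1 : ℝ) ^ (#W - k) * Real.exp (k * (x - 1)) := by
    have h2 : #W + 1 + k * (x - 1) ≤ (#W + 1) * Real.exp (k * (x - 1) / (#W + 1)) := by
      have := Real.add_one_le_exp (k * (x - 1) / (#W + 1))
      calc #W + 1 + k * (x - 1) = (#W + 1) * (k * (x - 1) / (#W + 1) + 1) := by field_simp; ring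
        _ ≤ _ := mul_le_mul_of_nonneg_left this h0.le
    refine (pow_le_pow_left₀ (by positivity) h2 _).trans ?_
    rw [mul_pow, ← Real.exp_nat_mul]
    refine mul_le_mul_of_nonneg_left (Real.exp_le_exp.2 ?_) (by positivity)
    rw [Nat.cast_sub hk, mul_div_assoc', div_le_iff₀ h0, mul_comm]
    refine mul_le_mul_of_nonneg_left ?_ hkx
    have : (0 : ℝ) ≤ k := by positivity
    linarith
  calc ((#W).descFactorial k : ℝ) * ((k * x + 1) * (#W + 1 + k * (x - 1)) ^ (#W - k))
      ≤ ((#W + 1) ^ k * Real.exp (-(k * (k + 1) / (2 * (#W + 1))))) *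
        ((k * x + 1) * ((#W + 1 : ℝ) ^ (#W - k) * Real.exp (k * (x - 1)))) := by
        refine mul_le_mul (descFactorial_le_exp _ _) ?_ (by positivity) (by positivity)
        exact mul_le_mul_of_nonneg_left h1 (by positivity)
    _ = (#W + 1 : ℝ) ^ (k + (#W - k)) * ((k * x + 1) *
        Real.exp (-(k * (k + 1) / (2 * (#W + 1))) + k * (x - 1))) := by
        rw [Real.exp_add, pow_add]; ring
    _ = _ := by
        rw [Nat.add_sub_cancel' hk, ← card_trees_mul hr]; ring

theorem sum_exp_neg_le {s : ℝ} (hs : 1 ≤ s) (K : ℕ) :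
    ∑ k ∈ range K, Real.exp (-(k / s)) ≤ 2 * s := by
  have h0 : 0 < s := by linarith
  have hq : Real.exp (-(1 / s)) < 1 := by simpa using h0
  have h1 : Real.exp (-(1 / s)) ≤ s / (s + 1) := by
    have := Real.add_one_le_exp (1 / s)
    rw [Real.exp_neg, inv_eq_one_div, div_le_div_iff₀ (Real.exp_pos _) (by linarith)]
    have h2 : s * (1 / s + 1) = s + 1 := by field_simp; ring
    nlinarith [mul_le_mul_of_nonneg_left this h0.le]
  have h2 : 1 / (s + 1) ≤ 1 - Real.exp (-(1 / s)) := by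
    have : 1 / (s + 1) = 1 - s / (s + 1) := by field_simp; ring
    linarith
  have h3 : ∀ k : ℕ, Real.exp (-(k / s)) = Real.exp (-(1 / s)) ^ k := by
    intro k
    rw [← Real.exp_nat_mul]
    congr 1
    ring
  simp_rw [h3]
  rw [geom_sum_eq hq.ne]
  have h4 : 0 < 1 - Real.exp (-(1 / s)) := by linarith
  rw [show (Real.exp (-(1 / s)) ^ K - 1) / (Real.exp (-(1 / s)) - 1) =
    (1 - Real.exp (-(1 / s)) ^ K) / (1 - Real.exp (-(1 / s))) by
      rw [← neg_sub 1, ← neg_sub 1 (Real.exp (-(1 / s))), neg_div_neg_eq], div_le_iff₀ h4]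
  have h5 : 0 ≤ Real.exp (-(1 / s)) ^ K := by positivity
  have h6 : 1 ≤ 2 * s * (1 / (s + 1)) := by
    rw [mul_one_div, le_div_iff₀ (by linarith)]; linarith
  nlinarith [mul_le_mul_of_nonneg_left h2 (by linarith : 0 ≤ 2 * s)]

/-- Gaussian sums. -/
theorem exists_gaussian_sum_le (b : ℝ) (j : ℕ) :
    ∃ C : ℝ, 0 < C ∧ ∀ (M : ℝ), 1 ≤ M → ∀ K : ℕ,
      ∑ k ∈ range K, ((k : ℝ) + 1) ^ j * Real.exp (-(k * (k + 1) / (4 * M)) + b * k / √M) ≤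
        C * √M ^ (j + 1) := by
  refine ⟨j.factorial * Real.exp (1 + (b + 2) ^ 2) * 2, by positivity, fun M hM K => ?_⟩
  have hs : 1 ≤ √M := by simpa using hM
  have hs2 : √M ^ 2 = M := Real.sq_sqrt (by linarith)
  set s := √M with hsdef
  have h0 : 0 < s := by linarith
  have key : ∀ k : ℕ, ((k : ℝ) + 1) ^ j * Real.exp (-(k * (k + 1) / (4 * M)) + b * k / s) ≤
      s ^ j * (j.factorial * Real.exp (1 + (b + 2) ^ 2)) * Real.exp (-(k / s)) := by
    intro k
    set y : ℝ := k / s with hy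
    have hy0 : 0 ≤ y := by positivity
    have hk : (k : ℝ) = s * y := by rw [hy]; field_simp
    have h1 : ((k : ℝ) + 1) ^ j ≤ s ^ j * (j.factorial * Real.exp (y + 1)) := by
      calc ((k : ℝ) + 1) ^ j ≤ (s * (y + 1)) ^ j :=
            pow_le_pow_left₀ (by positivity) (by rw [hk]; linarith) _
        _ = s ^ j * (y + 1) ^ j := mul_pow _ _ _
        _ ≤ _ := by
            refine mul_le_mul_of_nonneg_left ?_ (by positivity)
            have := Real.pow_div_factorial_le_exp (y + 1) (by linarith) j
            rwa [div_le_iff₀ (by positivity), mul_comm] at this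
    have h2 : -(k * (k + 1) / (4 * M)) + b * k / s ≤ -(y ^ 2 / 4) + b * y := by
      have e1 : b * k / s = b * y := by rw [hy]; ring
      have e2 : y ^ 2 / 4 ≤ k * (k + 1) / (4 * M) := by
        rw [hy, ← hs2, div_pow, div_div, mul_comm 4]
        refine div_le_div_of_nonneg_right ?_ (by positivity)
        have : (0 : ℝ) ≤ k := by positivity
        nlinarith
      linarith
    calc _ ≤ s ^ j * (j.factorial * Real.exp (y + 1)) * Real.exp (-(y ^ 2 / 4) + b * y) := by
          gcongr
      _ = s ^ j * (j.factorial * Real.exp ((y + 1) + (-(y ^ 2 / 4) + b * y))) := by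
          rw [Real.exp_add (y + 1)]; ring
      _ ≤ s ^ j * (j.factorial * Real.exp ((1 + (b + 2) ^ 2) + -y)) := by
          refine mul_le_mul_of_nonneg_left (mul_le_mul_of_nonneg_left (Real.exp_le_exp.2 ?_)
            (by positivity)) (by positivity)
          nlinarith [sq_nonneg (y / 2 - (b + 2))]
      _ = _ := by rw [Real.exp_add]; ring
  refine (sum_le_sum fun k _ => key k).trans ?_
  rw [← mul_sum]
  refine (mul_le_mul_of_nonneg_left (sum_exp_neg_le hs K) (by positivity)).trans (le_of_eq ?_)
  rw [pow_succ]
  ring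

theorem sum_trees_eq_sum_levelPairs {N : ℕ} (W : Finset (Fin N)) (r : Fin N)
    (f : (Fin N → Fin N) → Fin N → ℝ) :
    ∃ K : ℕ, ∑ T ∈ forests W {r}, ∑ u ∈ insert r W, f T u =
      ∑ k ∈ range K, ∑ q ∈ levelPairs W r k, f q.1 q.2 := by
  refine ⟨(forests W {r} ×ˢ insert r W).sup (fun q => hgt q.1 r q.2) + 1, ?_⟩
  rw [← sum_product (f := fun q => f q.1 q.2)]
  unfold levelPairs
  rw [sum_fiberwise_of_maps_to]
  intro q hq
  have := le_sup (f := fun q : (Fin N → Fin N) × Fin N => hgt q.1 r q.2) hq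
  rw [mem_range]
  exact Nat.lt_succ_of_le this

theorem exp_le_one_add_mul {c s : ℝ} (h0 : 0 ≤ s) (h1 : s ≤ 1) :
    Real.exp (c * s) ≤ 1 + (Real.exp c - 1) * s := by
  have := convexOn_exp.2 (Set.mem_univ 0) (Set.mem_univ c) (sub_nonneg.2 h1) h0 (by ring)
  simp only [smul_eq_mul, Real.exp_zero] at this
  rw [show (1 - s) * 0 + s * c = c * s by ring] at this
  linarith

/-- Joint moments of the height of a vertex and of the number of children of its path to the
root, summed over all trees and vertices. -/
theorem exists_moment_le {c : ℝ} (hc : 0 ≤ c) (j : ℕ) :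
    ∃ C : ℝ, 0 < C ∧ ∀ {N : ℕ} {W : Finset (Fin N)} {r : Fin N}, r ∉ W → ∀ h : ℕ,
      ∑ T ∈ forests W {r}, ∑ u ∈ insert r W,
        (if h ≤ hgt T r u then
          ((hgt T r u : ℝ) + 1) ^ j * Real.exp (c * #(spineChildren W T u) / √(#W + 1))
        else 0) ≤
        C * √(#W + 1) ^ (j + 2) * #(forests W {r}) * Real.exp (-(h ^ 2 / (4 * (#W + 1)))) := by
  obtain ⟨C, hC, hsum⟩ := exists_gaussian_sum_le (Real.exp c - 1) (j + 1)
  refine ⟨C * Real.exp c, by positivity, fun {N W r} hr h => ?_⟩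
  have hM : (1 : ℝ) ≤ #W + 1 := by
    have : (0 : ℝ) ≤ #W := by positivity
    linarith
  have hs : (1 : ℝ) ≤ √(#W + 1) := by simp
  set M : ℝ := #W + 1 with hMdef
  set s := √M with hsdef
  have h0 : 0 < s := by linarith
  set x := Real.exp (c / s) with hx
  have hcs : 0 ≤ c / s := by positivity
  have hx1 : 1 ≤ x := Real.one_le_exp hcs
  have hxc : x ≤ Real.exp c := Real.exp_le_exp.2 (div_le_self hc hs)
  have hxb : x - 1 ≤ (Real.exp c - 1) / s := by
    have := exp_le_one_add_mul (c := c) (s := 1 / s) (by positivity)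
      ((div_le_one h0).2 hs)
    rw [mul_one_div, mul_one_div] at this
    linarith
  obtain ⟨K, hK⟩ := sum_trees_eq_sum_levelPairs W r (fun T u =>
    if h ≤ hgt T r u then
      ((hgt T r u : ℝ) + 1) ^ j * Real.exp (c * #(spineChildren W T u) / s) else 0)
  rw [hK]
  set t : ℝ := (#(forests W {r}) : ℝ)
  have ht : 0 ≤ t := by positivity
  have key : ∀ k ∈ range K, ∑ q ∈ levelPairs W r k, (if h ≤ hgt q.1 r q.2 then
      ((hgt q.1 r q.2 : ℝ) + 1) ^ j * Real.exp (c * #(spineChildren W q.1 q.2) / s) else 0) ≤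
      Real.exp c * t * Real.exp (-(h ^ 2 / (4 * M))) *
        (((k : ℝ) + 1) ^ (j + 1) *
          Real.exp (-(k * (k + 1) / (4 * M)) + (Real.exp c - 1) * k / s)) := by
    intro k _
    have h1 : ∀ q ∈ levelPairs W r k, (if h ≤ hgt q.1 r q.2 then
      ((hgt q.1 r q.2 : ℝ) + 1) ^ j * Real.exp (c * #(spineChildren W q.1 q.2) / s) else 0) =
      (if h ≤ k then ((k : ℝ) + 1) ^ j else 0) * x ^ #(spineChildren W q.1 q.2) := by
      intro q hq
      rw [(levelPairs_spec hq).2.2, ite_mul, zero_mul, hx, ← Real.exp_nat_mul]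
      congr 3
      ring
    rw [sum_congr rfl h1, ← mul_sum]
    split_ifs with hk
    swap
    · rw [zero_mul]
      positivity
    have h2 := sum_levelPairs_le_exp hx1 hr k
    rw [← hMdef] at h2
    have hhk : (h : ℝ) ≤ k := by exact_mod_cast hk
    have hh0 : (0 : ℝ) ≤ h := by positivity
    have h3 : (k : ℝ) * x + 1 ≤ Real.exp c * (k + 1) := by
      have : (k : ℝ) * x ≤ k * Real.exp c := mul_le_mul_of_nonneg_left hxc (by positivity)
      have := Real.one_le_exp hc
      linarith
    have h4 : -(k * (k + 1) / (2 * M)) + k * (x - 1) ≤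
        -(h ^ 2 / (4 * M)) + (-(k * (k + 1) / (4 * M)) + (Real.exp c - 1) * k / s) := by
      have e1 : (h : ℝ) ^ 2 / (4 * M) ≤ k * (k + 1) / (4 * M) := by
        refine div_le_div_of_nonneg_right ?_ (by positivity)
        nlinarith
      have e2 : (k : ℝ) * (x - 1) ≤ (Real.exp c - 1) * k / s := by
        have := mul_le_mul_of_nonneg_left hxb (Nat.cast_nonneg k (α := ℝ))
        refine this.trans (le_of_eq ?_)
        ring
      have e3 : (k : ℝ) * (k + 1) / (2 * M) = k * (k + 1) / (4 * M) + k * (k + 1) / (4 * M) := by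
        field_simp; ring
      linarith
    calc _ ≤ ((k : ℝ) + 1) ^ j * (t * ((Real.exp c * (k + 1)) *
          Real.exp (-(h ^ 2 / (4 * M)) +
            (-(k * (k + 1) / (4 * M)) + (Real.exp c - 1) * k / s)))) := by
          refine mul_le_mul_of_nonneg_left (h2.trans ?_) (by positivity)
          refine mul_le_mul_of_nonneg_left ?_ ht
          exact mul_le_mul h3 (Real.exp_le_exp.2 h4) (by positivity) (by positivity)
      _ = _ := by rw [Real.exp_add (-(h ^ 2 / (4 * M)) : ℝ), pow_succ]; ring
  refine (sum_le_sum key).trans ?_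
  rw [← mul_sum]
  refine (mul_le_mul_of_nonneg_left (hsum M hM K) (by positivity)).trans (le_of_eq ?_)
  ring

theorem exists_exp_spineChildren_le {c : ℝ} (hc : 0 ≤ c) :
    ∃ C : ℝ, 0 < C ∧ ∀ {N : ℕ} {W : Finset (Fin N)} {r : Fin N}, r ∉ W →
      ∑ T ∈ forests W {r}, ∑ u ∈ insert r W,
        Real.exp (c * #(spineChildren W T u) / √(#W + 1)) ≤
        C * (#W + 1) * #(forests W {r}) := by
  obtain ⟨C, hC, h⟩ := exists_moment_le hc 0
  refine ⟨C, hC, fun {N W r} hr => ?_⟩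
  have := h hr 0
  simpa [Real.sq_sqrt (by positivity : (0 : ℝ) ≤ #W + 1)] using this

theorem exists_sum_hgt_pow_le :
    ∃ C : ℝ, 0 < C ∧ ∀ {N : ℕ} {W : Finset (Fin N)} {r : Fin N}, r ∉ W →
      ∑ T ∈ forests W {r}, ∑ u ∈ insert r W, ((hgt T r u : ℝ) + 1) ^ 4 ≤
        C * (#W + 1) ^ 3 * #(forests W {r}) := by
  obtain ⟨C, hC, h⟩ := exists_moment_le le_rfl 4
  refine ⟨C, hC, fun {N W r} hr => ?_⟩
  have := h hr 0
  rw [show 4 + 2 = 2 * 3 from rfl, pow_mul,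
    Real.sq_sqrt (by positivity : (0 : ℝ) ≤ #W + 1)] at this
  simpa using this

theorem exists_sum_card_hgt_ge_le :
    ∃ C : ℝ, 0 < C ∧ ∀ {N : ℕ} {W : Finset (Fin N)} {r : Fin N}, r ∉ W → ∀ h : ℕ,
      ∑ T ∈ forests W {r}, (#((insert r W).filter (fun u => h ≤ hgt T r u)) : ℝ) ≤
        C * (#W + 1) * #(forests W {r}) * Real.exp (-(h ^ 2 / (4 * (#W + 1)))) := by
  obtain ⟨C, hC, hs⟩ := exists_moment_le le_rfl 0
  refine ⟨C, hC, fun {N W r} hr h => ?_⟩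
  have := hs hr h
  simpa [Real.sq_sqrt (by positivity : (0 : ℝ) ≤ #W + 1)] using this

theorem reaches_of_hgt_ne_zero {N : ℕ} {T : Fin N → Fin N} {r v : Fin N} (h : hgt T r v ≠ 0) :
    Reaches T {r} v := by
  by_contra hc
  refine h ?_
  have : {k : ℕ | T^[k] v = r} = ∅ := by
    by_contra hne
    obtain ⟨k, hk⟩ := Set.nonempty_iff_ne_empty.2 hne
    exact hc (reaches_iff.2 ⟨k, by simpa using hk⟩)
  rw [hgt, this, Nat.sInf_empty]

theorem Reaches.hgt_iterate {N : ℕ} {T : Fin N → Fin N} {r v : Fin N} (h : Reaches T {r} v)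
    {i : ℕ} (hi : i ≤ hgt T r v) : hgt T r (T^[i] v) = hgt T r v - i := by
  refine le_antisymm (hgt_le ?_) (le_csInf ?_ ?_)
  · rw [← Function.iterate_add_apply, Nat.sub_add_cancel hi, h.iterate_hgt]
  · exact ⟨hgt T r v - i, by
      rw [Set.mem_ofPred_eq, ← Function.iterate_add_apply, Nat.sub_add_cancel hi, h.iterate_hgt]⟩
  · intro k hk
    have := hgt_le (T := T) (r := r) (u := v) (i := k + i)
      (by rw [Function.iterate_add_apply]; exact hk)
    omega

theorem Reaches.exists_le_hgt {N : ℕ} {T : Fin N → Fin N} {r u v : Fin N} (hr : T r = r)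
    (h : Reaches T {r} v) (hu : Anc T u v) : ∃ i ≤ hgt T r v, T^[i] v = u := by
  obtain ⟨i, rfl⟩ := hu
  rcases le_total i (hgt T r v) with hi | hi
  · exact ⟨i, hi, rfl⟩
  · refine ⟨hgt T r v, le_rfl, ?_⟩
    conv_rhs => rw [← Nat.sub_add_cancel hi]
    rw [Function.iterate_add_apply, h.iterate_hgt, Function.iterate_fixed hr]

/-- The strict descendants of `u`. -/
noncomputable def descSet {N : ℕ} (W : Finset (Fin N)) (T : Fin N → Fin N) (u : Fin N) :
    Finset (Fin N) :=
  W.filter (fun v => v ≠ u ∧ Anc T u v)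

/-- Replacing the parent map by another one on `J`. -/
noncomputable def splice {N : ℕ} (J : Finset (Fin N)) (T S : Fin N → Fin N) : Fin N → Fin N :=
  fun v => if v ∈ J then S v else T v

theorem IsForest.splice_id_descSet {N : ℕ} {W : Finset (Fin N)} {r u : Fin N}
    {T : Fin N → Fin N} (hr : r ∉ W) (hT : IsForest W {r} T) :
    IsForest (descSet W T u) {u} (splice (descSet W T u) id T) := by
  have hTr : T r = r := hT.1 r hr
  refine ⟨fun v hv => if_neg hv, fun v hv => ?_⟩
  have key : ∀ i v, T^[i] v = u → (v = u ∨ v ∈ descSet W T u) →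
      Reaches (splice (descSet W T u) id T) {u} v := by
    intro i
    induction i with
    | zero => exact fun v h _ => .base (by simpa using h)
    | succ i ih =>
      intro v hi hv
      rcases hv with rfl | hv
      · exact .base (by simp)
      · refine .step ?_
        have e : splice (descSet W T u) id T v = T v := if_pos hv
        rw [e]
        refine ih (T v) hi ?_
        have hvW := (mem_filter.1 hv).1
        have hmem := hT.par_mem (by simpa using hr) hvW
        rw [mem_union, mem_singleton] at hmem
        by_cases hu : T v = u
        · exact .inl hu
        rcases hmem with h | h
        · exact .inr (mem_filter.2 ⟨h, hu, i, hi⟩)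
        · have hi' : T^[i] (T v) = u := hi
          rw [h, Function.iterate_fixed hTr] at hi'
          exact absurd (h.trans hi') hu
  obtain ⟨i, hi⟩ := (mem_filter.1 hv).2.2
  exact key i v hi (.inr hv)

theorem IsForest.not_mem_descSet_step {N : ℕ} {W : Finset (Fin N)} {r u v : Fin N}
    {T : Fin N → Fin N} (hr : r ∉ W) (hT : IsForest W {r} T) (hv : v ∉ descSet W T u) :
    T v ∉ descSet W T u := by
  intro h
  by_cases hvW : v ∈ W
  · obtain ⟨h1, h2, h3⟩ := mem_filter.1 h
    have h4 : Anc T u v := h3.trans (anc_par v)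
    by_cases hvu : v = u
    · subst hvu
      exact h2 ((hT.2 v hvW).anc_antisymm (hT.1 r hr) (anc_par v) h3)
    · exact hv (mem_filter.2 ⟨hvW, hvu, h4⟩)
  · rw [hT.1 v hvW] at h
    exact hv h

theorem IsForest.iterate_splice {N : ℕ} {W : Finset (Fin N)} {r u v : Fin N}
    {T : Fin N → Fin N} (hr : r ∉ W) (hT : IsForest W {r} T) (S : Fin N → Fin N)
    (hv : v ∉ descSet W T u) (i : ℕ) :
    (splice (descSet W T u) T S)^[i] v = T^[i] v ∧ T^[i] v ∉ descSet W T u := by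
  induction i with
  | zero => exact ⟨rfl, hv⟩
  | succ i ih =>
    rw [Function.iterate_succ_apply', Function.iterate_succ_apply', ih.1]
    exact ⟨if_neg ih.2, hT.not_mem_descSet_step hr ih.2⟩

theorem reaches_splice {N : ℕ} {J : Finset (Fin N)} {u v : Fin N} {R : Finset (Fin N)}
    {T S : Fin N → Fin N} (hS : IsForest J {u} S) (hu : Reaches (splice J T S) R u) (hv : v ∈ J) :
    Reaches (splice J T S) R v := by
  have := hS.2 v hv
  clear hv
  induction this with
  | base h =>
    rw [mem_singleton] at h
    rwa [h]
  | @step v h ih =>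
    by_cases hv : v ∈ J
    · refine .step ?_
      have e : splice J T S v = S v := if_pos hv
      rwa [e]
    · rwa [hS.1 v hv] at ih

/-- The trees in which the vertex `u` has height `k` and set of strict descendants `J`. -/
noncomputable def treesDesc {N : ℕ} (W : Finset (Fin N)) (r u : Fin N) (J : Finset (Fin N))
    (k : ℕ) : Finset (Fin N → Fin N) :=
  (forests W {r}).filter (fun T => descSet W T u = J ∧ hgt T r u = k)

theorem splice_mem_treesDesc {N : ℕ} {W J : Finset (Fin N)} {r u : Fin N} {k : ℕ}
    {T S : Fin N → Fin N} (hr : r ∉ W) (hu : u ∈ insert r W) (hT : T ∈ treesDesc W r u J k)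
    (hS : S ∈ forests J {u}) : splice J T S ∈ treesDesc W r u J k := by
  rw [treesDesc, mem_filter, mem_forests] at hT
  rw [mem_forests] at hS
  obtain ⟨hT, rfl, rfl⟩ := hT
  have huJ : u ∉ descSet W T u := by simp [descSet]
  have hrJ : r ∉ descSet W T u := fun h => hr (mem_filter.1 h).1
  have hreach : ∀ v, v ∉ descSet W T u → Reaches T {r} v →
      Reaches (splice (descSet W T u) T S) {r} v := by
    intro v hv h
    obtain ⟨i, hi⟩ := reaches_iff.1 h
    exact reaches_iff.2 ⟨i, by rwa [(hT.iterate_splice hr S hv i).1]⟩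
  have hur : Reaches T {r} u := hT.reaches_of_mem (by simpa [or_comm] using hu)
  rw [treesDesc, mem_filter, mem_forests]
  refine ⟨⟨fun v hv => ?_, fun v hv => ?_⟩, ?_, ?_⟩
  · have : v ∉ descSet W T u := fun h => hv (mem_filter.1 h).1
    exact (if_neg this).trans (hT.1 v hv)
  · by_cases hvJ : v ∈ descSet W T u
    · exact reaches_splice hS (hreach u huJ hur) hvJ
    · exact hreach v hvJ (hT.2 v hv)
  · ext v
    constructor
    · intro hv
      by_contra hvJ
      obtain ⟨h1, h2, i, hi⟩ := mem_filter.1 hv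
      rw [(hT.iterate_splice hr S hvJ i).1] at hi
      exact hvJ (mem_filter.2 ⟨h1, h2, i, hi⟩)
    · intro hv
      have := reaches_splice (R := {u}) (T := T) hS (.base (mem_singleton_self u)) hv
      obtain ⟨i, hi⟩ := reaches_iff.1 this
      obtain ⟨h1, h2, -⟩ := mem_filter.1 hv
      exact mem_filter.2 ⟨h1, h2, i, by simpa using hi⟩
  · unfold hgt
    simp_rw [fun i => (hT.iterate_splice hr S huJ i).1]

theorem card_treesDesc_mul_le {N : ℕ} {W J : Finset (Fin N)} {r u : Fin N} {k : ℕ}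
    (hr : r ∉ W) (hu : u ∈ insert r W) (P : (Fin N → Fin N) → Prop) :
    #((treesDesc W r u J k).filter (fun T => P (splice J id T))) * #(forests J {u}) ≤
      #(treesDesc W r u J k) * #((forests J {u}).filter P) := by
  rw [← card_product, ← card_product]
  refine card_le_card_of_injOn (fun q => (splice J q.1 q.2, splice J id q.1)) ?_ ?_
  · rintro ⟨T, S⟩ hq
    rw [mem_coe, mem_product, mem_filter] at hq
    rw [mem_coe, mem_product, mem_filter]
    refine ⟨splice_mem_treesDesc hr hu hq.1.1 hq.2, ?_, hq.1.2⟩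
    have hT := hq.1.1
    rw [treesDesc, mem_filter, mem_forests] at hT
    rw [mem_forests]
    have := hT.1.splice_id_descSet (u := u) hr
    rwa [hT.2.1] at this
  · rintro ⟨T, S⟩ hq ⟨T', S'⟩ hq' h
    rw [mem_coe, mem_product, mem_forests] at hq hq'
    simp only [Prod.mk.injEq, splice, funext_iff, id] at h
    obtain ⟨h1, h2⟩ := h
    ext1
    · funext v
      have := h1 v
      have := h2 v
      by_cases hv : v ∈ J <;> simp_all
    · funext v
      have := h1 v
      by_cases hv : v ∈ J
      · simpa [hv] using this
      · exact (hq.2.1 v hv).trans (hq'.2.1 v hv).symm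

/-- A tree of large height contains a vertex at a given height whose subtree is high. -/
theorem exists_high_subtree {N : ℕ} {W : Finset (Fin N)} {r : Fin N} {T : Fin N → Fin N}
    (hT : IsForest W {r} T) {h k : ℕ} (hh : h ≤ treeHeight T r) (hk : k ≤ h)
    (h0 : 0 < h) : ∃ u ∈ insert r W, hgt T r u = k ∧
      h - k ≤ treeHeight (splice (descSet W T u) id T) u := by
  obtain ⟨v, -, hv⟩ := exists_mem_eq_sup univ ⟨r, mem_univ r⟩ (hgt T r)
  rw [treeHeight, hv] at hh
  have hvr : Reaches T {r} v := reaches_of_hgt_ne_zero (by omega)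
  have hik : hgt T r v - k ≤ hgt T r v := Nat.sub_le _ _
  refine ⟨T^[hgt T r v - k] v, ?_, ?_, ?_⟩
  · rcases hik.lt_or_eq with h | h
    · exact mem_insert_of_mem (hT.iterate_mem hvr h)
    · rw [h, hvr.iterate_hgt]
      exact mem_insert_self _ _
  · rw [hvr.hgt_iterate hik]
    omega
  · set i := hgt T r v - k with hi
    set J := descSet W T (T^[i] v)
    have hJ : ∀ j < i, T^[j] v ∈ J := fun j hj => mem_filter.2
      ⟨hT.iterate_mem hvr (by omega), hvr.iterate_ne hj hik, i - j, by
        rw [← Function.iterate_add_apply, Nat.sub_add_cancel hj.le]⟩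
    have hit : ∀ j ≤ i, (splice J id T)^[j] v = T^[j] v := by
      intro j
      induction j with
      | zero => simp
      | succ j ih =>
        intro hj
        rw [Function.iterate_succ_apply', Function.iterate_succ_apply', ih (by omega)]
        exact if_pos (hJ j hj)
    refine le_trans ?_ (le_sup (f := hgt (splice J id T) (T^[i] v)) (mem_univ v))
    refine le_trans (by omega : h - k ≤ i) (le_csInf ⟨i, hit i le_rfl⟩ ?_)
    intro j hj
    by_contra hc
    rw [Set.mem_ofPred_eq, hit j (by omega)] at hj
    exact hvr.iterate_ne (by omega) hik hj

theorem IsForest.sum_card_descSet_le {N : ℕ} {W : Finset (Fin N)} {r : Fin N}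
    {T : Fin N → Fin N} (hr : r ∉ W) (hT : IsForest W {r} T) (k : ℕ) :
    ∑ u ∈ (insert r W).filter (fun u => hgt T r u = k), (#(descSet W T u) + 1) ≤
      #((insert r W).filter (fun v => k ≤ hgt T r v)) := by
  have hreach : ∀ v ∈ insert r W, Reaches T {r} v := fun v hv =>
    hT.reaches_of_mem (by simpa [or_comm] using hv)
  rw [card_eq_sum_card_fiberwise (f := fun v => T^[hgt T r v - k] v)
    (t := (insert r W).filter (fun u => hgt T r u = k))]
  · refine sum_le_sum fun u hu => ?_
    rw [mem_filter] at hu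
    rw [← card_insert_of_notMem (a := u) (s := descSet W T u) (by simp [descSet])]
    refine card_le_card fun v hv => ?_
    have hv' : v ∈ insert r W ∧ Anc T u v := by
      rcases mem_insert.1 hv with rfl | hv
      · exact ⟨hu.1, Anc.refl _⟩
      · exact ⟨mem_insert_of_mem (mem_filter.1 hv).1, (mem_filter.1 hv).2.2⟩
    obtain ⟨i, hi, hiu⟩ := (hreach v hv'.1).exists_le_hgt (hT.1 r hr) hv'.2
    have := (hreach v hv'.1).hgt_iterate hi
    rw [hiu, hu.2] at this
    rw [mem_filter, mem_filter]
    refine ⟨⟨hv'.1, by omega⟩, ?_⟩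
    rw [show hgt T r v - k = i by omega, hiu]
  · intro v hv
    rw [mem_coe, mem_filter] at hv
    rw [mem_coe, mem_filter]
    have hvr := hreach v hv.1
    have hik : hgt T r v - k ≤ hgt T r v := Nat.sub_le _ _
    refine ⟨?_, by rw [hvr.hgt_iterate hik]; omega⟩
    change T^[hgt T r v - k] v ∈ insert r W
    rcases hik.lt_or_eq with h | h
    · exact mem_insert_of_mem (hT.iterate_mem hvr h)
    · rw [h, hvr.iterate_hgt]
      exact mem_insert_self _ _

theorem card_treeHeight_ge_le {N : ℕ} {W : Finset (Fin N)} {r : Fin N} {h k : ℕ} (hk : k ≤ h)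
    (h0 : 0 < h) :
    #((forests W {r}).filter (fun T => h ≤ treeHeight T r)) ≤
      ∑ u ∈ insert r W, ∑ J ∈ W.powerset, #((treesDesc W r u J k).filter
        (fun T => h - k ≤ treeHeight (splice J id T) u)) := by
  rw [← sum_product']
  refine le_trans (card_le_card fun T hT => ?_) card_biUnion_le
  rw [mem_filter, mem_forests] at hT
  obtain ⟨u, hu, hku, hsub⟩ := exists_high_subtree hT.1 hT.2 hk h0
  rw [mem_biUnion]
  exact ⟨(u, descSet W T u), mem_product.2 ⟨hu, mem_powerset.2 (filter_subset _ _)⟩,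
    mem_filter.2 ⟨mem_filter.2 ⟨mem_forests.2 hT.1, rfl, hku⟩, hsub⟩⟩

theorem card_trees_pos {N : ℕ} {W : Finset (Fin N)} {r : Fin N} (hr : r ∉ W) :
    (0 : ℝ) < #(forests W {r}) := by
  have := card_trees_mul hr
  have h0 : (0 : ℝ) < (#W + 1) ^ #W := by positivity
  rw [← this] at h0
  exact pos_of_mul_pos_left h0 (by positivity)

/-- The tail of the height of a uniform tree. -/
theorem exists_card_treeHeight_ge_mul_le :
    ∃ C : ℝ, 0 < C ∧ ∀ (h : ℕ) {N : ℕ} {W : Finset (Fin N)} {r : Fin N}, r ∉ W →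
      (#((forests W {r}).filter (fun T => h ≤ treeHeight T r)) : ℝ) * (h : ℝ) ^ 8 ≤
        C * (#W + 1) ^ 4 * #(forests W {r}) := by
  obtain ⟨c, hc, hsum⟩ := exists_sum_card_hgt_ge_le
  set B : ℝ := 36 * (256 * c) + 4 with hB
  have hB0 : 0 < B := by positivity
  refine ⟨B ^ 4, by positivity, fun h => ?_⟩
  induction h using Nat.strong_induction_on with
  | _ h ih =>
    intro N W r hr
    set m : ℝ := #W + 1 with hm
    have hm1 : 1 ≤ m := by
      have : (0 : ℝ) ≤ #W := by positivity
      linarith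
    set t : ℝ := (#(forests W {r}) : ℝ) with ht
    have ht0 : 0 < t := card_trees_pos hr
    rcases le_or_gt ((h : ℝ) ^ 2) (B * m) with hsmall | hlarge
    · have h1 : (#((forests W {r}).filter (fun T => h ≤ treeHeight T r)) : ℝ) ≤ t := by
        exact Nat.cast_le.2 (card_le_card (filter_subset _ _))
      calc _ ≤ t * (B * m) ^ 4 := by
            refine mul_le_mul h1 ?_ (by positivity) ht0.le
            rw [show (h : ℝ) ^ 8 = ((h : ℝ) ^ 2) ^ 4 by ring]
            exact pow_le_pow_left₀ (by positivity) hsmall _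
        _ = _ := by ring
    have h3 : 3 ≤ h := by
      by_contra hc
      have : (h : ℝ) ≤ 2 := by exact_mod_cast (by omega : h ≤ 2)
      have hh0 : (0 : ℝ) ≤ h := by positivity
      nlinarith
    set k := h / 2 with hk
    set l := h - k with hl
    have hk3 : h ≤ 3 * k := by omega
    have hl2 : h ≤ 2 * l := by omega
    have step1 : ∀ u ∈ insert r W, ∀ J ∈ W.powerset,
        (#((treesDesc W r u J k).filter (fun T => l ≤ treeHeight (splice J id T) u)) : ℝ) *
          (l : ℝ) ^ 8 ≤ B ^ 4 * m ^ 3 * (#(treesDesc W r u J k) * (#J + 1)) := by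
      intro u hu J hJ
      rcases (treesDesc W r u J k).eq_empty_or_nonempty with he | ⟨T, hT⟩
      · simp [he]
      have huJ : u ∉ J := by
        rw [← (mem_filter.1 hT).2.1]
        simp [descSet]
      have hpos := card_trees_pos huJ
      have h1 : #((treesDesc W r u J k).filter (fun T => l ≤ treeHeight (splice J id T) u)) *
          #(forests J {u}) ≤
          #(treesDesc W r u J k) * #((forests J {u}).filter (fun S => l ≤ treeHeight S u)) := by
        convert card_treesDesc_mul_le (J := J) (k := k) hr hu (fun S => l ≤ treeHeight S u)
      have h1' : (#((treesDesc W r u J k).filter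
          (fun T => l ≤ treeHeight (splice J id T) u)) : ℝ) * #(forests J {u}) ≤
          #(treesDesc W r u J k) * #((forests J {u}).filter (fun S => l ≤ treeHeight S u)) := by
        exact_mod_cast h1
      have h2 := ih l (by omega) huJ
      have hJm : (#J + 1 : ℝ) ≤ m := by
        have : (#J : ℝ) ≤ #W := by exact_mod_cast card_le_card (mem_powerset.1 hJ)
        linarith
      refine le_of_mul_le_mul_right ?_ hpos
      calc _ = (#((treesDesc W r u J k).filter
            (fun T => l ≤ treeHeight (splice J id T) u)) : ℝ) * #(forests J {u}) *
              (l : ℝ) ^ 8 := by ring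
        _ ≤ #(treesDesc W r u J k) * #((forests J {u}).filter (fun S => l ≤ treeHeight S u)) *
              (l : ℝ) ^ 8 := mul_le_mul_of_nonneg_right h1' (by positivity)
        _ = #(treesDesc W r u J k) * (#((forests J {u}).filter (fun S => l ≤ treeHeight S u)) *
              (l : ℝ) ^ 8) := by ring
        _ ≤ #(treesDesc W r u J k) * (B ^ 4 * (#J + 1) ^ 4 * #(forests J {u})) :=
              mul_le_mul_of_nonneg_left h2 (by positivity)
        _ = #(treesDesc W r u J k) * (B ^ 4 * (#J + 1) ^ 3 * (#J + 1) * #(forests J {u})) := by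
              ring
        _ ≤ #(treesDesc W r u J k) * (B ^ 4 * m ^ 3 * (#J + 1) * #(forests J {u})) := by
              gcongr
        _ = _ := by ring
    have step2 : ∑ u ∈ insert r W, ∑ J ∈ W.powerset,
        ((#(treesDesc W r u J k) : ℝ) * (#J + 1)) ≤
          ∑ T ∈ forests W {r}, (#((insert r W).filter (fun v => k ≤ hgt T r v)) : ℝ) := by
      have e1 : ∀ u, ∑ J ∈ W.powerset, ((#(treesDesc W r u J k) : ℝ) * (#J + 1)) =
          ∑ T ∈ forests W {r}, if hgt T r u = k then (#(descSet W T u) + 1 : ℝ) else 0 := by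
        intro u
        rw [← sum_filter, ← sum_fiberwise_of_maps_to (g := fun T => descSet W T u)
          (t := W.powerset) (fun T _ => mem_powerset.2 (filter_subset _ _))]
        refine sum_congr rfl fun J _ => ?_
        rw [sum_congr rfl (g := fun _ => (#J + 1 : ℝ)) (fun T hT => by
          rw [(mem_filter.1 hT).2]), sum_const, nsmul_eq_mul, filter_filter]
        congr 3
        unfold treesDesc
        refine filter_congr fun T _ => and_comm
      simp_rw [e1]
      rw [sum_comm]
      refine sum_le_sum fun T hT => ?_
      rw [← sum_filter]
      exact_mod_cast (mem_forests.1 hT).sum_card_descSet_le hr k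
    have step3 : (#((forests W {r}).filter (fun T => h ≤ treeHeight T r)) : ℝ) * (l : ℝ) ^ 8 ≤
        B ^ 4 * m ^ 3 * (c * m * t * Real.exp (-(k ^ 2 / (4 * m)))) := by
      have h1 : (#((forests W {r}).filter (fun T => h ≤ treeHeight T r)) : ℝ) ≤
          ∑ u ∈ insert r W, ∑ J ∈ W.powerset, (#((treesDesc W r u J k).filter
            (fun T => l ≤ treeHeight (splice J id T) u)) : ℝ) := by
        exact_mod_cast card_treeHeight_ge_le (W := W) (r := r) (by omega : k ≤ h) (by omega)
      refine (mul_le_mul_of_nonneg_right h1 (by positivity)).trans ?_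
      rw [sum_mul]
      simp_rw [sum_mul]
      refine (sum_le_sum fun u hu => sum_le_sum fun J hJ => step1 u hu J hJ).trans ?_
      simp_rw [← mul_sum]
      exact mul_le_mul_of_nonneg_left (step2.trans (hsum hr k)) (by positivity)
    have step4 : 256 * c * Real.exp (-(k ^ 2 / (4 * m))) ≤ 1 := by
      have e1 : 256 * c ≤ (k : ℝ) ^ 2 / (4 * m) := by
        rw [le_div_iff₀ (by positivity)]
        have : (h : ℝ) ≤ 3 * k := by exact_mod_cast hk3
        have hh0 : (0 : ℝ) ≤ h := by positivity
        have : (h : ℝ) ^ 2 ≤ 9 * (k : ℝ) ^ 2 := by nlinarith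
        nlinarith
      rw [Real.exp_neg, ← div_eq_mul_inv, div_le_one (Real.exp_pos _)]
      have := Real.add_one_le_exp ((k : ℝ) ^ 2 / (4 * m))
      linarith
    have step5 : (h : ℝ) ^ 8 ≤ 256 * (l : ℝ) ^ 8 := by
      have : (h : ℝ) ≤ 2 * l := by exact_mod_cast hl2
      calc (h : ℝ) ^ 8 ≤ (2 * l) ^ 8 := pow_le_pow_left₀ (by positivity) this _
        _ = _ := by ring
    calc _ ≤ (#((forests W {r}).filter (fun T => h ≤ treeHeight T r)) : ℝ) *
          (256 * (l : ℝ) ^ 8) := mul_le_mul_of_nonneg_left step5 (by positivity)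
      _ = 256 * ((#((forests W {r}).filter (fun T => h ≤ treeHeight T r)) : ℝ) *
          (l : ℝ) ^ 8) := by ring
      _ ≤ 256 * (B ^ 4 * m ^ 3 * (c * m * t * Real.exp (-(k ^ 2 / (4 * m))))) :=
          mul_le_mul_of_nonneg_left step3 (by norm_num)
      _ = B ^ 4 * m ^ 4 * t * (256 * c * Real.exp (-(k ^ 2 / (4 * m)))) := by ring
      _ ≤ B ^ 4 * m ^ 4 * t * 1 := mul_le_mul_of_nonneg_left step4 (by positivity)
      _ = _ := by ring

theorem isPTree_iff_mem_forests {m : ℕ} {par : Fin m → Fin m} {r : Fin m} :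
    IsPTree par r ↔ par ∈ forests (univ.erase r) {r} := by
  rw [mem_forests]
  constructor
  · intro ht
    refine ⟨fun v hv => ?_, fun v _ => ht.reaches v⟩
    obtain rfl : v = r := by simpa using hv
    exact ht.1
  · intro hT
    refine ⟨hT.1 r (by simp), fun v => ?_⟩
    simpa using reaches_iff.1 (hT.reaches_of_mem (u := v) (by simp))

theorem card_univ_erase_add_one {m : ℕ} (r : Fin m) :
    ((#(univ.erase r) : ℕ) : ℝ) + 1 = m := by
  exact_mod_cast (card_erase_add_one (mem_univ r)).trans (by simp)

/-- The vertices which are children of a proper ancestor of `u`, but not ancestors of `u`. -/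
noncomputable def numSpineChildren {m : ℕ} (par : Fin m → Fin m) (r u : Fin m) : ℕ :=
  #(spineChildren (univ.erase r) par u)

theorem mem_spineChildren_of_permitted {m : ℕ} {par : Fin m → Fin m} {r : Fin m}
    (ht : IsPTree par r) {u v : Fin m} (h : (u, v) ∈ permitted par r) :
    v ∈ spineChildren (univ.erase r) par u := by
  obtain ⟨hu, hv, ha, hn⟩ := permitted_spec ht h
  refine mem_filter.2 ⟨mem_erase.2 ⟨hv, mem_univ v⟩, hn, ha.trans (anc_par u), fun he => ?_⟩
  rw [he] at ha
  have hfix : par u = u := ht.anc_antisymm (anc_par u) ha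
  obtain ⟨k, hk⟩ := ht.2 u
  rw [Function.iterate_fixed hfix] at hk
  exact hu hk

theorem sum_permitted_le {m : ℕ} {par : Fin m → Fin m} {r : Fin m} (ht : IsPTree par r)
    (f : Fin m → ℕ) :
    ∑ q ∈ permitted par r, f q.1 ≤ ∑ u, numSpineChildren par r u * f u := by
  calc ∑ q ∈ permitted par r, f q.1
      ≤ ∑ q : Fin m × Fin m with q.2 ∈ spineChildren (univ.erase r) par q.1, f q.1 := by
        refine sum_le_sum_of_subset fun q hq => ?_
        exact mem_filter.2 ⟨mem_univ q, mem_spineChildren_of_permitted ht hq⟩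
    _ = ∑ u, ∑ _v ∈ spineChildren (univ.erase r) par u, f u :=
        sum_finset_product _ _ _ (by simp)
    _ = _ := by simp [numSpineChildren]

theorem area_le {m : ℕ} {par : Fin m → Fin m} {r : Fin m} (ht : IsPTree par r) :
    area par r ≤ ∑ u, numSpineChildren par r u := by
  simpa [area] using sum_permitted_le ht (fun _ => 1)

theorem card_anc_le {m : ℕ} {par : Fin m → Fin m} {r : Fin m} (ht : IsPTree par r) (u : Fin m) :
    #(univ.filter (fun y => Anc par y u)) ≤ hgt par r u + 1 := by
  have : univ.filter (fun y => Anc par y u) =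
      insert r (univ.image (spine par u (hgt par r u))) := by
    ext y
    simpa using anc_iff_mem_spine ht.1 (ht.reaches u)
  rw [this]
  exact (card_insert_le _ _).trans (Nat.add_le_add_right (card_image_le.trans (by simp)) 1)

/-- The union bound for a pair of independent random subsets. -/
theorem sum_bernW_mul_bernW_union {m : ℕ} {p : ℝ} (h0 : 0 ≤ p) (h1 : p ≤ 1)
    (A B : Finset (Fin m × Fin m)) {ι : Type*} (I : Finset ι)
    (E F : ι → Finset (Fin m × Fin m)) (k : ℕ) (hk : ∀ i ∈ I, #(E i) + #(F i) = k)
    (P : (Fin m → Fin m → Bool) → (Fin m → Fin m → Bool) → Prop)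
    (hP : ∀ b s, P b s → (∀ u w, s u w = true → (u, w) ∈ B) →
      ∃ i ∈ I, (∀ x ∈ E i, b x.1 x.2 = true) ∧ ∀ x ∈ F i, s x.1 x.2 = true) :
    ∑ b, ∑ s, bernW p A b * bernW p B s * (if P b s then 1 else 0) ≤ p ^ k * #I := by
  let G : Finset (Fin m × Fin m) → Finset (Fin m × Fin m) → (Fin m → Fin m → Bool) → ℝ :=
    fun A E b => bernW p A b * (if ∀ x ∈ E, b x.1 x.2 = true then 1 else 0)
  have hG : ∀ A E b, 0 ≤ G A E b := fun A E b =>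
    mul_nonneg (bernW_nonneg h0 h1 A b) (by split_ifs <;> norm_num)
  calc ∑ b, ∑ s, bernW p A b * bernW p B s * (if P b s then 1 else 0)
      ≤ ∑ b, ∑ s, ∑ i ∈ I, G A (E i) b * G B (F i) s := by
        refine sum_le_sum fun b _ => sum_le_sum fun s _ => ?_
        have hnn : ∀ i ∈ I, 0 ≤ G A (E i) b * G B (F i) s :=
          fun i _ => mul_nonneg (hG _ _ _) (hG _ _ _)
        by_cases hB : ∀ u w, s u w = true → (u, w) ∈ B
        · by_cases hb : P b s
          · obtain ⟨i, hi, hx, hy⟩ := hP b s hb hB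
            refine le_trans (le_of_eq ?_) (single_le_sum hnn hi)
            simp only [G]
            rw [if_pos hb, if_pos hx, if_pos hy]
            ring
          · simpa [hb] using sum_nonneg hnn
        · have : bernW p B s = 0 := if_neg hB
          simpa [this] using sum_nonneg hnn
    _ = ∑ i ∈ I, (∑ b, G A (E i) b) * ∑ s, G B (F i) s := by
        simp_rw [sum_mul_sum]
        rw [sum_comm]
        simp_rw [sum_comm (s := I)]
        rw [sum_comm]
    _ ≤ ∑ i ∈ I, p ^ k := by
        refine sum_le_sum fun i hi => ?_
        rw [← hk i hi, pow_add]
        exact mul_le_mul (sum_bernW_mul_le h0 A (E i)) (sum_bernW_mul_le h0 B (F i))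
          (sum_nonneg fun s _ => hG _ _ _) (by positivity)
    _ = p ^ k * #I := by rw [sum_const, nsmul_eq_mul, mul_comm]

/-- The probability of an event given the tree. -/
noncomputable def condProb {m : ℕ} (p : ℝ) (par : Fin m → Fin m) (r : Fin m)
    (P : (Fin m → Fin m → Bool) → (Fin m → Fin m → Bool) → Prop) : ℝ :=
  ∑ b, ∑ s, backW p par r b * surpW p par r s * (if P b s then 1 else 0)

theorem condProb_le_add {m : ℕ} {p : ℝ} (h0 : 0 ≤ p) (h1 : p ≤ 1) {par : Fin m → Fin m}
    {r : Fin m} (ht : IsPTree par r)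
    {P Q R : (Fin m → Fin m → Bool) → (Fin m → Fin m → Bool) → Prop}
    (h : ∀ b s, Admissible par r b s → P b s → Q b s ∨ R b s) :
    condProb p par r P ≤ condProb p par r Q + condProb p par r R := by
  simp_rw [condProb, ← sum_add_distrib]
  refine sum_le_sum fun b _ => sum_le_sum fun s _ => ?_
  rw [← mul_add]
  have hnn : 0 ≤ backW p par r b * surpW p par r s := by
    rw [backW_eq_bernW, surpW_eq_bernW]
    exact mul_nonneg (bernW_nonneg h0 h1 _ _) (bernW_nonneg h0 h1 _ _)
  by_cases hb : ∀ u w, b u w = true → dfsPos par r w < dfsPos par r u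
  · by_cases hs : ∀ u w, s u w = true → (u, w) ∈ permitted par r
    · refine mul_le_mul_of_nonneg_left ?_ hnn
      have := h b s ⟨ht, hb, hs⟩
      by_cases hP : P b s
      · rcases this hP with hQ | hR
        · rw [if_pos hP, if_pos hQ]
          split_ifs <;> norm_num
        · rw [if_pos hP, if_pos hR]
          split_ifs <;> norm_num
      · rw [if_neg hP]
        split_ifs <;> norm_num
    · simp [surpW, if_neg hs]
  · simp [backW, if_neg hb]

theorem condProb_const {m : ℕ} (p : ℝ) (par : Fin m → Fin m) (r : Fin m) (P : Prop) :
    condProb p par r (fun _ _ => P) = if P then 1 else 0 := by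
  simp_rw [condProb, backW_eq_bernW, surpW_eq_bernW, ← sum_mul, ← sum_mul_sum, sum_bernW]
  simp

/-- Some back edge and surplus edge, the first of which leads to an ancestor of either tail. -/
def CrossEvent {m : ℕ} (par : Fin m → Fin m) (b s : Fin m → Fin m → Bool) : Prop :=
  ∃ x z u v, b x z = true ∧ s u v = true ∧ (Anc par z x ∨ Anc par z u)

/-- Two different back edges lead to ancestors of the tail of the first one. -/
def DoubleEvent {m : ℕ} (par : Fin m → Fin m) (b : Fin m → Fin m → Bool) : Prop :=
  ∃ x y x' y', b x y = true ∧ b x' y' = true ∧ (x, y) ≠ (x', y') ∧ Anc par y x ∧ Anc par y' x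

/-- The quantity controlling the probability of `CrossEvent` and `DoubleEvent`. -/
noncomputable def treeEnergy {m : ℕ} (par : Fin m → Fin m) (r : Fin m) : ℝ :=
  ∑ u, ((numSpineChildren par r u : ℝ) ^ 2 + ((hgt par r u : ℝ) + 1) ^ 2)

theorem condProb_doubleEvent_le {m : ℕ} {p : ℝ} (h0 : 0 ≤ p) (h1 : p ≤ 1)
    {par : Fin m → Fin m} {r : Fin m} (ht : IsPTree par r) :
    condProb p par r (fun b _ => DoubleEvent par b) ≤ p ^ 2 * (m * treeEnergy par r) := by
  let A : Fin m → Finset (Fin m) := fun x => univ.filter (fun y => Anc par y x)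
  let I : Finset (Σ _ : Fin m, Fin m × Fin m × Fin m) :=
    (univ.sigma (fun x => A x ×ˢ A x ×ˢ univ)).filter
      (fun i => (i.1, i.2.1) ≠ (i.2.2.2, i.2.2.1))
  have hI : (#I : ℝ) ≤ m * treeEnergy par r := by
    have : #I ≤ ∑ x, #(A x) * (#(A x) * m) :=
      (card_filter_le _ _).trans (by simp [card_sigma, card_product])
    refine (Nat.cast_le.2 this).trans ?_
    push_cast
    rw [treeEnergy, mul_sum]
    refine sum_le_sum fun x _ => ?_
    have hA : (#(A x) : ℝ) ≤ hgt par r x + 1 := by exact_mod_cast card_anc_le ht x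
    have : (#(A x) : ℝ) ^ 2 ≤ (hgt par r x + 1) ^ 2 := by gcongr
    calc (#(A x) : ℝ) * (#(A x) * m) = m * (0 + (#(A x) : ℝ) ^ 2) := by ring
      _ ≤ _ := by gcongr; positivity
  rw [condProb, backW_eq_bernW, surpW_eq_bernW]
  refine (sum_bernW_mul_bernW_union h0 h1 _ _ I
    (fun i => {(i.1, i.2.1), (i.2.2.2, i.2.2.1)}) (fun _ => ∅) 2 ?_ _ ?_).trans ?_
  · intro i hi
    rw [card_pair (mem_filter.1 hi).2, card_empty]
  · rintro b s ⟨x, y, x', y', hb, hb', hne, ha, ha'⟩ -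
    exact ⟨⟨x, y, y', x'⟩, by simpa [I, A, ha, ha'] using hne,
      by simp [hb, hb'], by simp⟩
  · gcongr

theorem condProb_crossEvent_le {m : ℕ} {p : ℝ} (h0 : 0 ≤ p) (h1 : p ≤ 1)
    {par : Fin m → Fin m} {r : Fin m} (ht : IsPTree par r) :
    condProb p par r (CrossEvent par) ≤ p ^ 2 * (m * treeEnergy par r) := by
  let A : Fin m → Finset (Fin m) := fun x => univ.filter (fun y => Anc par y x)
  let I : Finset ((Fin m × Fin m) × (Fin m × Fin m)) := univ.filter (fun i =>
    i.2 ∈ permitted par r ∧ (Anc par i.1.2 i.1.1 ∨ Anc par i.1.2 i.2.1))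
  have hI1 : #I ≤ ∑ q ∈ permitted par r, (∑ x, #(A x) + m * #(A q.1)) := by
    have hsub : I ⊆ (permitted par r).biUnion (fun q =>
        ((univ.sigma A).image (fun i => ((i.1, i.2), q))) ∪
          (univ ×ˢ A q.1).image (fun i => (i, q))) := by
      rintro ⟨⟨x, z⟩, q⟩ hi
      simp only [I, mem_filter, mem_univ, true_and] at hi
      simp only [mem_biUnion, mem_union, mem_image]
      refine ⟨q, hi.1, hi.2.imp (fun h => ⟨⟨x, z⟩, ?_, rfl⟩) (fun h => ⟨(x, z), ?_, rfl⟩)⟩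
      · simpa [A] using h
      · simpa [A] using h
    refine (card_le_card hsub).trans (card_biUnion_le.trans (sum_le_sum fun q _ => ?_))
    refine (card_union_le _ _).trans (Nat.add_le_add (card_image_le.trans ?_)
      (card_image_le.trans ?_))
    · rw [card_sigma]
    · simp [card_product]
  have hI2 := hI1.trans (sum_permitted_le ht (fun u => ∑ x, #(A x) + m * #(A u)))
  have hI : (#I : ℝ) ≤ m * treeEnergy par r := by
    have hA : ∀ x, (#(A x) : ℝ) ≤ hgt par r x + 1 := fun x => by
      exact_mod_cast card_anc_le ht x
    have hpt : ∀ u x, (numSpineChildren par r u : ℝ) * #(A x) ≤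
        ((numSpineChildren par r u : ℝ) ^ 2 + ((hgt par r x : ℝ) + 1) ^ 2) / 2 := by
      intro u x
      have h2 : (numSpineChildren par r u : ℝ) * #(A x) ≤
          numSpineChildren par r u * (hgt par r x + 1) := by
        gcongr
        exact hA x
      nlinarith [sq_nonneg ((numSpineChildren par r u : ℝ) - (hgt par r x + 1))]
    refine (Nat.cast_le.2 hI2).trans ?_
    push_cast
    simp_rw [mul_add, mul_sum]
    rw [sum_add_distrib]
    have e1 : ∑ u : Fin m, ∑ x : Fin m,
        ((numSpineChildren par r u : ℝ) ^ 2 + ((hgt par r x : ℝ) + 1) ^ 2) / 2 =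
        m * treeEnergy par r / 2 := by
      simp_rw [← sum_div, sum_add_distrib, treeEnergy, sum_const, card_univ, Fintype.card_fin,
        nsmul_eq_mul, ← mul_sum]
      rw [sum_add_distrib]
      ring
    have e2 : ∑ u : Fin m, (numSpineChildren par r u : ℝ) * (m * #(A u)) ≤
        m * treeEnergy par r / 2 := by
      rw [treeEnergy, mul_sum, sum_div]
      refine sum_le_sum fun u _ => ?_
      calc (numSpineChildren par r u : ℝ) * (m * #(A u))
          = m * (numSpineChildren par r u * #(A u)) := by ring
        _ ≤ m * (((numSpineChildren par r u : ℝ) ^ 2 + ((hgt par r u : ℝ) + 1) ^ 2) / 2) := by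
            gcongr
            exact hpt u u
        _ = _ := by ring
    have e3 := (sum_le_sum fun u (_ : u ∈ univ) => sum_le_sum fun x (_ : x ∈ univ) =>
      hpt u x).trans_eq e1
    linarith
  rw [condProb, backW_eq_bernW, surpW_eq_bernW]
  refine (sum_bernW_mul_bernW_union h0 h1 _ _ I
    (fun i => {i.1}) (fun i => {i.2}) 2 (by simp) _ ?_).trans ?_
  · rintro b s ⟨x, z, u, v, hb, hs, ha⟩ hS
    exact ⟨((x, z), (u, v)), by simpa [I] using ⟨hS u v hs, ha⟩, by simpa using hb,
      by simpa using hs⟩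
  · gcongr

theorem exists_sum_treeEnergy_sq_le :
    ∃ C : ℝ, 0 < C ∧ ∀ {m : ℕ} (r : Fin m),
      ∑ T ∈ forests (univ.erase r) {r}, treeEnergy T r ^ 2 ≤
        C * (m : ℝ) ^ 4 * #(forests (univ.erase r) {r}) := by
  obtain ⟨C₁, hC₁, h₁⟩ := exists_exp_spineChildren_le (c := 1) zero_le_one
  obtain ⟨C₂, hC₂, h₂⟩ := exists_sum_hgt_pow_le
  refine ⟨2 * (24 * C₁ + C₂), by positivity, fun {m} r => ?_⟩
  have hr : r ∉ univ.erase r := notMem_erase r univ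
  have hm : (0 : ℝ) < m := by exact_mod_cast Fin.pos r
  have h₁ := h₁ hr
  have h₂ := h₂ hr
  simp only [card_univ_erase_add_one, insert_erase (mem_univ r)] at h₁ h₂
  set t := (#(forests (univ.erase r) {r}) : ℝ)
  have hpt : ∀ T : Fin m → Fin m, treeEnergy T r ^ 2 ≤ 2 * m * (24 * (m : ℝ) ^ 2 *
      ∑ u, Real.exp (1 * #(spineChildren (univ.erase r) T u) / √m) +
        ∑ u, ((hgt T r u : ℝ) + 1) ^ 4) := by
    intro T
    have h := sq_sum_le_card_mul_sum_sq (s := (univ : Finset (Fin m)))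
      (f := fun u => (numSpineChildren T r u : ℝ) ^ 2 + ((hgt T r u : ℝ) + 1) ^ 2)
    refine h.trans ?_
    rw [card_univ, Fintype.card_fin, mul_sum _ _ (24 * (m : ℝ) ^ 2), ← sum_add_distrib, mul_sum,
      mul_sum]
    refine sum_le_sum fun u _ => ?_
    have h4 : (numSpineChildren T r u : ℝ) ^ 4 ≤ 24 * (m : ℝ) ^ 2 *
        Real.exp (1 * #(spineChildren (univ.erase r) T u) / √m) := by
      have := Real.pow_div_factorial_le_exp ((numSpineChildren T r u : ℝ) / √m)
        (by positivity) 4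
      rw [div_pow, div_div, div_le_iff₀ (by positivity),
        show √(m : ℝ) ^ 4 = (√(m : ℝ) ^ 2) ^ 2 by ring, Real.sq_sqrt hm.le] at this
      rw [one_mul]
      refine this.trans_eq ?_
      rw [show Nat.factorial 4 = 24 from rfl]
      push_cast
      unfold numSpineChildren
      ring
    have h5 := sq_nonneg ((numSpineChildren T r u : ℝ) ^ 2 - ((hgt T r u : ℝ) + 1) ^ 2)
    calc (m : ℝ) * ((numSpineChildren T r u : ℝ) ^ 2 + ((hgt T r u : ℝ) + 1) ^ 2) ^ 2
        ≤ m * (2 * ((numSpineChildren T r u : ℝ) ^ 4 + ((hgt T r u : ℝ) + 1) ^ 4)) := by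
          gcongr
          linarith
      _ = 2 * m * ((numSpineChildren T r u : ℝ) ^ 4 + ((hgt T r u : ℝ) + 1) ^ 4) := by ring
      _ ≤ _ := by gcongr
  refine (sum_le_sum fun T _ => hpt T).trans ?_
  rw [← mul_sum, sum_add_distrib, ← mul_sum]
  calc _ ≤ 2 * (m : ℝ) * (24 * (m : ℝ) ^ 2 * (C₁ * m * t) + C₂ * (m : ℝ) ^ 3 * t) := by gcongr
    _ = _ := by ring

theorem biasW_sq_le {m : ℕ} {p : ℝ} (h0 : 0 ≤ p) (h1 : p ≤ 1 / 2)
    (hpm : p * (m * √m) ≤ 2) {T : Fin m → Fin m} {r : Fin m} (ht : IsPTree T r) :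
    biasW p T r ^ 2 ≤
      (∑ u, Real.exp (8 * #(spineChildren (univ.erase r) T u) / √m)) / m := by
  have hm : (0 : ℝ) < m := by exact_mod_cast Fin.pos r
  have hexp : (1 - p)⁻¹ ≤ Real.exp (2 * p) := by
    rw [inv_le_comm₀ (by linarith) (Real.exp_pos _), ← Real.exp_neg]
    have h2 := Real.add_one_le_exp (2 * p)
    rw [Real.exp_neg, inv_le_comm₀ (Real.exp_pos _) (by linarith)]
    refine le_trans ?_ h2
    rw [inv_le_iff_one_le_mul₀ (by linarith)]
    nlinarith
  have hsum : (area T r : ℝ) ≤ ∑ u, (numSpineChildren T r u : ℝ) := by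
    exact_mod_cast area_le ht
  have hjensen := convexOn_exp.map_sum_le (t := univ) (w := fun _ : Fin m => (1 : ℝ) / m)
    (p := fun u => 8 * (numSpineChildren T r u : ℝ) / √m) (fun _ _ => by positivity)
    (by simp [hm.ne']) (fun _ _ => Set.mem_univ _)
  simp only [smul_eq_mul] at hjensen
  rw [biasW, if_pos ht, ← inv_pow, ← pow_mul]
  calc ((1 - p)⁻¹) ^ (area T r * 2) ≤ Real.exp (2 * p) ^ (area T r * 2) := by
        have : 0 ≤ (1 - p)⁻¹ := inv_nonneg.2 (by linarith)
        gcongr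
    _ = Real.exp (4 * p * area T r) := by
        rw [← Real.exp_nat_mul]
        push_cast
        ring_nf
    _ ≤ Real.exp (∑ u, 1 / (m : ℝ) * (8 * numSpineChildren T r u / √m)) := by
        rw [Real.exp_le_exp]
        have hs : (0 : ℝ) < √m := Real.sqrt_pos.2 hm
        have e : ∑ u, 1 / (m : ℝ) * (8 * numSpineChildren T r u / √m) =
            8 * (∑ u, (numSpineChildren T r u : ℝ)) / (m * √m) := by
          rw [mul_sum, sum_div]
          exact sum_congr rfl fun u _ => by field_simp
        rw [e, le_div_iff₀ (by positivity)]
        calc 4 * p * area T r * (m * √m) = 4 * area T r * (p * (m * √m)) := by ring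
          _ ≤ 4 * area T r * 2 := by gcongr
          _ ≤ _ := by linarith
    _ ≤ _ := hjensen
    _ = _ := by
        rw [← mul_sum, one_div, inv_mul_eq_div]
        rfl

theorem one_le_biasW {m : ℕ} {p : ℝ} (h0 : 0 ≤ p) (h1 : p ≤ 1 / 2) {T : Fin m → Fin m}
    {r : Fin m} (ht : IsPTree T r) : 1 ≤ biasW p T r := by
  rw [biasW, if_pos ht]
  exact (one_le_inv₀ (pow_pos (by linarith) _)).2 (pow_le_one₀ (by linarith) (by linarith))

theorem exists_sum_biasW_sq_le :
    ∃ C : ℝ, 0 < C ∧ ∀ {m : ℕ} (r : Fin m) {p : ℝ}, 0 ≤ p → p ≤ 1 / 2 → p * (m * √m) ≤ 2 →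
      ∑ T ∈ forests (univ.erase r) {r}, biasW p T r ^ 2 ≤
        C * #(forests (univ.erase r) {r}) := by
  obtain ⟨C, hC, h⟩ := exists_exp_spineChildren_le (c := 8) (by norm_num)
  refine ⟨C, hC, fun {m} r p h0 h1 hpm => ?_⟩
  have hm : (0 : ℝ) < m := by exact_mod_cast Fin.pos r
  have h := h (notMem_erase r univ)
  simp only [card_univ_erase_add_one, insert_erase (mem_univ r)] at h
  refine (sum_le_sum fun T hT => biasW_sq_le h0 h1 hpm (isPTree_iff_mem_forests.2 hT)).trans ?_
  rw [← sum_div, div_le_iff₀ hm]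
  refine h.trans_eq (by ring)

theorem modelProb_eq {m : ℕ} (hm : 0 < m) (p : ℝ)
    (ev : ∀ m' : ℕ, (Fin m' → Fin m') → Fin m' →
      (Fin m' → Fin m' → Bool) → (Fin m' → Fin m' → Bool) → Prop) :
    modelProb m p ev =
      (∑ T ∈ forests (univ.erase ⟨0, hm⟩) {⟨0, hm⟩},
        biasW p T ⟨0, hm⟩ * condProb p T ⟨0, hm⟩ (ev m T ⟨0, hm⟩)) /
      ∑ T ∈ forests (univ.erase ⟨0, hm⟩) {⟨0, hm⟩}, biasW p T ⟨0, hm⟩ := by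
  have hz : ∀ T ∉ forests (univ.erase ⟨0, hm⟩) {(⟨0, hm⟩ : Fin m)}, biasW p T ⟨0, hm⟩ = 0 :=
    fun T hT => if_neg (mt isPTree_iff_mem_forests.1 hT)
  rw [modelProb, dif_pos hm]
  dsimp only
  congr 1
  · rw [← sum_subset (subset_univ (forests (univ.erase ⟨0, hm⟩) {(⟨0, hm⟩ : Fin m)}))]
    · refine sum_congr rfl fun T _ => ?_
      simp_rw [condProb, mul_sum, mul_assoc]
    · intro T _ hT
      simp [hz T hT]
  · exact (sum_subset (subset_univ _) fun T _ hT => hz T hT).symm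

theorem modelProb_le_add {m : ℕ} (hm : 0 < m) {p : ℝ} (h0 : 0 ≤ p) (h1 : p ≤ 1 / 2)
    {ev ev₁ ev₂ : ∀ m' : ℕ, (Fin m' → Fin m') → Fin m' →
      (Fin m' → Fin m' → Bool) → (Fin m' → Fin m' → Bool) → Prop}
    (h : ∀ T b s, Admissible T ⟨0, hm⟩ b s → ev m T ⟨0, hm⟩ b s →
      ev₁ m T ⟨0, hm⟩ b s ∨ ev₂ m T ⟨0, hm⟩ b s) :
    modelProb m p ev ≤ modelProb m p ev₁ + modelProb m p ev₂ := by
  simp_rw [modelProb_eq hm]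
  rw [← add_div, ← sum_add_distrib]
  have hw : ∀ T ∈ forests (univ.erase ⟨0, hm⟩) {(⟨0, hm⟩ : Fin m)}, 0 ≤ biasW p T ⟨0, hm⟩ :=
    fun T hT => zero_le_one.trans (one_le_biasW h0 h1 (isPTree_iff_mem_forests.2 hT))
  refine div_le_div_of_nonneg_right (sum_le_sum fun T hT => ?_) (sum_nonneg hw)
  rw [← mul_add]
  exact mul_le_mul_of_nonneg_left (condProb_le_add h0 (by linarith)
    (isPTree_iff_mem_forests.2 hT) (h T)) (hw T hT)

/-- Probabilities under the biased law are controlled by second moments under the uniform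
law. -/
theorem exists_modelProb_le_of_sum_sq_le :
    ∃ C : ℝ, 0 < C ∧ ∀ {m : ℕ} (hm : 0 < m) {p : ℝ}, 0 ≤ p → p ≤ 1 / 2 → p * (m * √m) ≤ 2 →
      ∀ (ev : ∀ m' : ℕ, (Fin m' → Fin m') → Fin m' →
        (Fin m' → Fin m' → Bool) → (Fin m' → Fin m' → Bool) → Prop)
        (F : (Fin m → Fin m) → ℝ) (K : ℝ), 0 ≤ K →
        (∀ T, IsPTree T ⟨0, hm⟩ → condProb p T ⟨0, hm⟩ (ev m T ⟨0, hm⟩) ≤ F T) →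
        ∑ T ∈ forests (univ.erase ⟨0, hm⟩) {⟨0, hm⟩}, F T ^ 2 ≤
          K ^ 2 * #(forests (univ.erase ⟨0, hm⟩) {(⟨0, hm⟩ : Fin m)}) →
        modelProb m p ev ≤ C * K := by
  obtain ⟨C, hC, h⟩ := exists_sum_biasW_sq_le
  refine ⟨√C, Real.sqrt_pos.2 hC, fun {m} hm p h0 h1 hpm ev F K hK hF hsum => ?_⟩
  rw [modelProb_eq hm]
  have h := h ⟨0, hm⟩ h0 h1 hpm
  have ht : (0 : ℝ) < #(forests (univ.erase ⟨0, hm⟩) {(⟨0, hm⟩ : Fin m)}) :=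
    card_trees_pos (notMem_erase _ _)
  set r : Fin m := ⟨0, hm⟩
  set S := forests (univ.erase r) {r}
  have hw : ∀ T ∈ S, 1 ≤ biasW p T r :=
    fun T hT => one_le_biasW h0 h1 (isPTree_iff_mem_forests.2 hT)
  have hden : (#S : ℝ) ≤ ∑ T ∈ S, biasW p T r := by
    simpa using card_nsmul_le_sum S _ 1 hw
  rw [div_le_iff₀ (ht.trans_le hden)]
  calc ∑ T ∈ S, biasW p T r * condProb p T r (ev m T r) ≤ ∑ T ∈ S, biasW p T r * F T :=
        sum_le_sum fun T hT => mul_le_mul_of_nonneg_left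
          (hF T (isPTree_iff_mem_forests.2 hT)) (zero_le_one.trans (hw T hT))
    _ ≤ √C * K * #S := by
        refine abs_le_of_sq_le_sq' ?_ (by positivity) |>.2
        calc _ ≤ (∑ T ∈ S, biasW p T r ^ 2) * ∑ T ∈ S, F T ^ 2 := sum_mul_sq_le_sq_mul_sq _ _ _
          _ ≤ (C * #S) * (K ^ 2 * #S) := mul_le_mul h hsum (by positivity) (by positivity)
          _ = (√C ^ 2) * K ^ 2 * (#S : ℝ) ^ 2 := by rw [Real.sq_sqrt hC.le]; ring
          _ = _ := by ring
    _ ≤ _ := mul_le_mul_of_nonneg_left hden (by positivity)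

theorem exists_modelProb_cycleEvent_le :
    ∃ C : ℝ, 0 < C ∧ ∀ {m : ℕ}, 0 < m → ∀ {p : ℝ}, 0 ≤ p → p ≤ 1 / 2 → p * (m * √m) ≤ 2 →
      modelProb m p (fun _ T _ b s => CrossEvent T b s ∨ DoubleEvent T b) ≤
        C * (p ^ 2 * (m : ℝ) ^ 3) := by
  obtain ⟨C₁, hC₁, h₁⟩ := exists_modelProb_le_of_sum_sq_le
  obtain ⟨C₂, hC₂, h₂⟩ := exists_sum_treeEnergy_sq_le
  refine ⟨C₁ * (2 * √C₂), by positivity, fun {m} hm p h0 h1 hpm => ?_⟩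
  rw [mul_assoc]
  refine h₁ hm h0 h1 hpm _ (fun T => 2 * (p ^ 2 * (m * treeEnergy T ⟨0, hm⟩))) _
    (by positivity) (fun T ht => ?_) ?_
  · have hp1 : p ≤ 1 := by linarith
    refine (condProb_le_add (Q := CrossEvent T) (R := fun b _ => DoubleEvent T b) h0 hp1 ht
      fun b s _ h => h).trans ?_
    rw [two_mul]
    exact add_le_add (condProb_crossEvent_le h0 hp1 ht) (condProb_doubleEvent_le h0 hp1 ht)
  · calc _ = 4 * p ^ 4 * (m : ℝ) ^ 2 *
          ∑ T ∈ forests (univ.erase ⟨0, hm⟩) {⟨0, hm⟩}, treeEnergy T ⟨0, hm⟩ ^ 2 := by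
          rw [mul_sum]
          exact sum_congr rfl fun T _ => by ring
      _ ≤ 4 * p ^ 4 * (m : ℝ) ^ 2 *
          (C₂ * (m : ℝ) ^ 4 * #(forests (univ.erase ⟨0, hm⟩) {(⟨0, hm⟩ : Fin m)})) := by
          gcongr
          exact h₂ _
      _ = (2 * (p ^ 2 * (m : ℝ) ^ 3)) ^ 2 * √C₂ ^ 2 *
          #(forests (univ.erase ⟨0, hm⟩) {(⟨0, hm⟩ : Fin m)}) := by
          rw [Real.sq_sqrt hC₂.le]
          ring
      _ = _ := by ring

theorem exists_modelProb_treeHeight_le :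
    ∃ C : ℝ, 0 < C ∧ ∀ {m : ℕ}, 0 < m → ∀ {p : ℝ}, 0 ≤ p → p ≤ 1 / 2 → p * (m * √m) ≤ 2 →
      ∀ x : ℝ, 0 < x → modelProb m p (fun _ T r _ _ => x ≤ treeHeight T r) ≤
        C * ((m : ℝ) ^ 2 / x ^ 4) := by
  obtain ⟨C₁, hC₁, h₁⟩ := exists_modelProb_le_of_sum_sq_le
  obtain ⟨C₂, hC₂, h₂⟩ := exists_card_treeHeight_ge_mul_le
  refine ⟨C₁ * √C₂, by positivity, fun {m} hm p h0 h1 hpm x hx => ?_⟩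
  rw [mul_assoc]
  refine h₁ hm h0 h1 hpm _ (fun T => if x ≤ treeHeight T ⟨0, hm⟩ then 1 else 0) _
    (by positivity) (fun T ht => (condProb_const p T _ _).le) ?_
  have h := h₂ ⌈x⌉₊ (notMem_erase (⟨0, hm⟩ : Fin m) univ)
  rw [card_univ_erase_add_one] at h
  have hx' : x ≤ ⌈x⌉₊ := Nat.le_ceil x
  simp only [ite_pow, one_pow, ne_eq, OfNat.ofNat_ne_zero, not_false_eq_true, zero_pow]
  rw [sum_boole, show (√C₂ * ((m : ℝ) ^ 2 / x ^ 4)) ^ 2 *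
      #(forests (univ.erase ⟨0, hm⟩) {(⟨0, hm⟩ : Fin m)}) = √C₂ ^ 2 * (m : ℝ) ^ 4 *
      #(forests (univ.erase ⟨0, hm⟩) {(⟨0, hm⟩ : Fin m)}) / x ^ 8 by ring,
    Real.sq_sqrt hC₂.le, le_div_iff₀ (by positivity)]
  refine le_trans ?_ h
  simp only [← Nat.ceil_le]
  gcongr

theorem Admissible.crossEvent_or_doubleEvent {m : ℕ} {par : Fin m → Fin m} {r : Fin m}
    {b s : Fin m → Fin m → Bool} (h : Admissible par r b s) (w : Fin m) :
    (CrossEvent par b s ∨ DoubleEvent par b) ∨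
      ((sccEdges (edgeX par r b s) w).ncard ≤ {v | SameSCC (edgeX par r b s) w v}.ncard ∧
        {v | SameSCC (edgeX par r b s) w v}.ncard ≤ treeHeight par r + 1) := by
  by_cases hs : ∃ a c, s a c = true ∧ SameSCC (edgeX par r b s) a c
  · obtain ⟨a, c, hac, hS⟩ := hs
    exact .inl (.inl (h.of_surplus_mem hac hS))
  · push Not at hs
    exact (h.scc_cases w hs).imp_left .inr

end RandomTree

open RandomTree Filter in
theorem eventually_bounds_of_critical {lam : ℝ} {p : ℕ → ℝ}
    (hp : Tendsto (fun n : ℕ =>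
      (p n - 1 / (n:ℝ) - lam * (n:ℝ) ^ (-(4:ℝ)/3)) * (n:ℝ) ^ ((4:ℝ)/3))
      atTop (nhds 0)) :
    ∀ᶠ n : ℕ in atTop, 0 < n ∧ 0 ≤ p n ∧ p n ≤ 1 / 2 ∧ p n ≤ 2 / n := by
  have hq : Tendsto (fun n : ℕ => (n : ℝ) ^ ((1:ℝ)/3)) atTop atTop :=
    (tendsto_rpow_atTop (by norm_num)).comp tendsto_natCast_atTop_atTop
  filter_upwards [hp.eventually (Metric.ball_mem_nhds 0 one_pos), eventually_ge_atTop 4,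
    hq.eventually_ge_atTop (1 + |lam|)] with n hn hn4 hqn
  have hn4' : (4 : ℝ) ≤ n := by exact_mod_cast hn4
  have hn0 : (0 : ℝ) < n := by linarith
  rw [Real.dist_0_eq_abs] at hn
  set q : ℝ := (n : ℝ) ^ ((1:ℝ)/3) with hqdef
  have hq0 : 0 < q := by positivity
  have e4 : (n : ℝ) ^ ((4:ℝ)/3) = n * q := by
    rw [hqdef, ← Real.rpow_one_add' hn0.le (by norm_num)]
    norm_num
  have e4' : (n : ℝ) ^ (-(4:ℝ)/3) = (n * q)⁻¹ := by
    rw [neg_div, Real.rpow_neg hn0.le, e4]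
  rw [e4, e4', show (p n - 1 / (n:ℝ) - lam * (n * q)⁻¹) * (n * q) = (p n * n - 1) * q - lam by
    field_simp] at hn
  have h1 : |(p n * n - 1) * q| ≤ q := by
    have := abs_add_le ((p n * n - 1) * q - lam) lam
    rw [sub_add_cancel] at this
    linarith
  rw [abs_mul, abs_of_pos hq0] at h1
  have h2 := abs_le.1 (le_of_mul_le_mul_right (h1.trans_eq (one_mul q).symm) hq0)
  have h3 : p n ≤ 2 / n := (le_div_iff₀ hn0).2 (by linarith)
  refine ⟨by omega, nonneg_of_mul_nonneg_left (by linarith) hn0, h3.trans ?_, h3⟩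
  rw [div_le_div_iff₀ hn0 two_pos]
  linarith

open RandomTree Filter in
/-- Let `λ ∈ ℝ` and `p = p(n) = 1/n + λ n^{-4/3} + o(n^{-4/3})`.
There is a `C > 0` such that for all `n` large enough and all `1 ≤ m ≤ n^{2/3}`, the
random directed graph `X_m` (built from the biased tree `T_m` with back and surplus
edges added independently with probability `p(n)`) satisfies
`P[X_m has a complex strongly connected component] ≤ C·m³/n²` and
`P[X_m has a strongly connected component containing a surplus edge] ≤ C·m³/n²`;
moreover, for every `ε > 0` there is a `C > 0` such that for all `n` large enough and all
`1 ≤ m ≤ n^{2/3}`, `P[‖T_m‖ ≥ n^{1/3} ε] ≤ C·m²/n^{4/3}` and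
`P[X_m has a strongly connected component with more than n^{1/3} ε edges] ≤ C·m²/n^{4/3}`. -/
theorem critical_window_component_bounds
    (lam : ℝ) (p : ℕ → ℝ)
    (hp : Tendsto (fun n : ℕ =>
      (p n - 1 / (n:ℝ) - lam * (n:ℝ) ^ (-(4:ℝ)/3)) * (n:ℝ) ^ ((4:ℝ)/3))
      atTop (nhds 0)) :
    (∃ C : ℝ, 0 < C ∧ ∃ N : ℕ, ∀ n : ℕ, N ≤ n → ∀ m : ℕ, 1 ≤ m →
      (m:ℝ) ≤ (n:ℝ) ^ ((2:ℝ)/3) →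
        modelProb m (p n) (fun m' par r b s => HasComplexSCC (edgeX par r b s))
          ≤ C * (m:ℝ) ^ 3 / (n:ℝ) ^ 2 ∧
        modelProb m (p n) (fun m' par r b s =>
            ∃ a c : Fin m', s a c = true ∧ SameSCC (edgeX par r b s) a c)
          ≤ C * (m:ℝ) ^ 3 / (n:ℝ) ^ 2) ∧
    (∀ ε : ℝ, 0 < ε → ∃ C : ℝ, 0 < C ∧ ∃ N : ℕ, ∀ n : ℕ, N ≤ n → ∀ m : ℕ, 1 ≤ m →
      (m:ℝ) ≤ (n:ℝ) ^ ((2:ℝ)/3) →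
        modelProb m (p n) (fun m' par r b s =>
            (n:ℝ) ^ ((1:ℝ)/3) * ε ≤ (treeHeight par r : ℝ))
          ≤ C * (m:ℝ) ^ 2 / (n:ℝ) ^ ((4:ℝ)/3) ∧
        modelProb m (p n) (fun m' par r b s =>
            ∃ u : Fin m', (n:ℝ) ^ ((1:ℝ)/3) * ε < ((sccEdges (edgeX par r b s) u).ncard : ℝ))
          ≤ C * (m:ℝ) ^ 2 / (n:ℝ) ^ ((4:ℝ)/3)) := by
  obtain ⟨C₁, hC₁, hcycle⟩ := exists_modelProb_cycleEvent_le
  obtain ⟨C₂, hC₂, hheight⟩ := exists_modelProb_treeHeight_le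
  have hpow : ∀ (n k : ℕ), ((n : ℝ) ^ ((1:ℝ)/3)) ^ k = (n : ℝ) ^ ((k : ℝ) / 3) := fun n k => by
    rw [← Real.rpow_natCast, ← Real.rpow_mul (by positivity), one_div_mul_eq_div]
  have hwindow : ∀ {n m : ℕ}, p n ≤ 2 / n → 0 < n → (m:ℝ) ≤ (n:ℝ) ^ ((2:ℝ)/3) →
      p n * (m * √m) ≤ 2 := by
    intro n m hpn hn hm
    set q : ℝ := (n : ℝ) ^ ((1:ℝ)/3)
    have hq0 : 0 < q := by positivity
    have hm2 : (m : ℝ) ≤ q ^ 2 := hm.trans_eq (by rw [hpow]; norm_num)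
    have hs : √(m : ℝ) ≤ q := Real.sqrt_le_left hq0.le |>.2 hm2
    have hn' : (0 : ℝ) < n := by exact_mod_cast hn
    calc p n * (m * √m) ≤ 2 / n * (q ^ 2 * q) := by gcongr
      _ = 2 / n * q ^ 3 := by ring
      _ = 2 := by
        rw [hpow]
        norm_num
        field_simp
  have hsq : ∀ {n m : ℕ}, 0 ≤ p n → p n ≤ 2 / n →
      C₁ * (p n ^ 2 * (m : ℝ) ^ 3) ≤ 4 * C₁ * (m : ℝ) ^ 3 / (n : ℝ) ^ 2 := by
    intro n m h0 hpn
    calc C₁ * (p n ^ 2 * (m : ℝ) ^ 3) ≤ C₁ * ((2 / n) ^ 2 * (m : ℝ) ^ 3) := by gcongr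
      _ = _ := by ring
  have hcyc := fun {n m : ℕ} (hm : 1 ≤ m) (h0 : 0 ≤ p n) (h1 : p n ≤ 1 / 2) (hpn : p n ≤ 2 / n)
    (hn : 0 < n) (hmn : (m:ℝ) ≤ (n:ℝ) ^ ((2:ℝ)/3)) =>
      (hcycle hm h0 h1 (hwindow hpn hn hmn)).trans (hsq h0 hpn)
  have hzero : ∀ {n m : ℕ}, 0 < m → modelProb m (p n) (fun _ _ _ _ _ => False) = 0 := by
    intro n m hm
    rw [modelProb_eq hm]
    simp [condProb]
  refine ⟨⟨4 * C₁, by positivity, ?_⟩, fun ε hε => ?_⟩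
  · obtain ⟨N, hN⟩ := eventually_atTop.1 (eventually_bounds_of_critical hp)
    refine ⟨N, fun n hn m hm hmn => ?_⟩
    obtain ⟨hn0, h0, h1, hpn⟩ := hN n hn
    have key := hcyc hm h0 h1 hpn hn0 hmn
    constructor
    · refine le_trans (modelProb_le_add hm h0 h1 (ev₂ := fun _ _ _ _ _ => False)
        fun T b s hA ⟨u, hu⟩ => ?_) ((congrArg _ (hzero hm)).trans (add_zero _) |>.trans_le key)
      exact .inl ((hA.crossEvent_or_doubleEvent u).resolve_right fun h => by omega)
    · refine le_trans (modelProb_le_add hm h0 h1 (ev₂ := fun _ _ _ _ _ => False)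
        fun T b s hA ⟨a, c, hac, hS⟩ => ?_)
        ((congrArg _ (hzero hm)).trans (add_zero _) |>.trans_le key)
      exact .inl (.inl (hA.of_surplus_mem hac hS))
  · have hq : Tendsto (fun n : ℕ => (n : ℝ) ^ ((1:ℝ)/3)) atTop atTop :=
      (tendsto_rpow_atTop (by norm_num)).comp tendsto_natCast_atTop_atTop
    obtain ⟨N, hN⟩ := eventually_atTop.1
      ((eventually_bounds_of_critical hp).and (hq.eventually_ge_atTop (2 / ε)))
    refine ⟨4 * C₁ + 16 * C₂ / ε ^ 4, by positivity, N, fun n hn m hm hmn => ?_⟩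
    obtain ⟨⟨hn0, h0, h1, hpn⟩, hqn⟩ := hN n hn
    have hn' : (0 : ℝ) < n := by exact_mod_cast hn0
    have hwin := hwindow hpn hn0 hmn
    have key := hcyc hm h0 h1 hpn hn0 hmn
    have e2 := hpow n 2
    have e3 := hpow n 3
    have e4 := hpow n 4
    norm_num at e2 e3 e4
    rw [div_le_iff₀ hε] at hqn
    set q : ℝ := (n : ℝ) ^ ((1:ℝ)/3) with hqdef
    have hq0 : 0 < q := by positivity
    rw [← e2] at hmn
    rw [← e4]
    constructor
    · refine (hheight hm h0 h1 hwin (q * ε) (by positivity)).trans ?_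
      rw [mul_pow, show C₂ * ((m : ℝ) ^ 2 / (q ^ 4 * ε ^ 4)) =
        C₂ / ε ^ 4 * (m : ℝ) ^ 2 / q ^ 4 by field_simp]
      gcongr
      rw [show 16 * C₂ / ε ^ 4 = 16 * (C₂ / ε ^ 4) by ring]
      have : 0 < C₂ / ε ^ 4 := by positivity
      linarith
    · refine (modelProb_le_add hm h0 h1 (ev₂ := fun _ T r _ _ => q * (ε / 2) ≤ treeHeight T r)
        fun T b s hA ⟨u, hu⟩ => ?_).trans
        ((add_le_add key (hheight hm h0 h1 hwin (q * (ε / 2)) (by positivity))).trans ?_)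
      · refine (hA.crossEvent_or_doubleEvent u).imp_right fun h => ?_
        have : ((sccEdges (edgeX T ⟨0, hm⟩ b s) u).ncard : ℝ) ≤ treeHeight T ⟨0, hm⟩ + 1 := by
          exact_mod_cast h.1.trans h.2
        linarith
      · have e6 : (n : ℝ) ^ 2 = q ^ 6 := by rw [← e3]; ring
        have hmm : (m : ℝ) ^ 3 / q ^ 6 ≤ (m : ℝ) ^ 2 / q ^ 4 := by
          rw [div_le_div_iff₀ (by positivity) (by positivity)]
          calc (m : ℝ) ^ 3 * q ^ 4 = (m : ℝ) ^ 2 * q ^ 4 * m := by ring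
            _ ≤ (m : ℝ) ^ 2 * q ^ 4 * q ^ 2 := by gcongr
            _ = _ := by ring
        rw [e6, show (4 * C₁ + 16 * C₂ / ε ^ 4) * (m : ℝ) ^ 2 / q ^ 4 =
          4 * C₁ * ((m : ℝ) ^ 2 / q ^ 4) + C₂ * ((m : ℝ) ^ 2 / (q * (ε / 2)) ^ 4) by
          field_simp
          ring, mul_div_assoc]
        gcongr
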